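/- arXiv:2308.07620 — 3 statements merged into one kernel-verified Lean document; each statement's English description precedes it below -/
import Mathlib

section
/- Fix τ ∈ ℍ and k ∈ {1,2,3}. Let a₁, a₂ ∈ ℂ with a₁ − a₂ ∉ Λ_τ and a₁, a₂ ∉ ±ω_k/4 + Λ_τ, and for c ∈ ℂ define y(z) = e^{cz}·σ(z − a₁|τ)·σ(z − a₂|τ)/(σ(z − ω_k/4|τ)·σ(z + ω_k/4|τ)). Then there exist c, T, E ∈ ℂ such that y solves y″(z) = q_k(z;T,E)·y(z) on ℂ if and only if (1/2)(ζ(a₂ + ω_k/4|τ) + ζ(a₂ − ω_k/4|τ)) = (1/2)(ζ(a₁ + ω_k/4|τ) + ζ(a₁ − ω_k/4|τ)) − ζ(a₁ − a₂|τ). Moreover, in that case c, T, E are determined by: −T = η_k(τ) − Σ_{i=1}^{2}(ζ(a_i + ω_k/4|τ) − ζ(a_i − ω_k/4|τ)); −E = T²/4 − (η_k(τ)/2)T − 3e_k(τ) + Σ_{i=1}^{2}℘(a_i − ω_k/4|τ); and c = T/2 + η_k(τ)/2 + Σ_{i=1}^{2}ζ(a_i − ω_k/4|τ). -/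
open Metric Set Filter Topology

noncomputable section

/-- The lattice `Λ_τ = ℤ + τℤ` as a set of complex numbers. -/
def lat (τ : ℂ) : Set ℂ := {z | ∃ m n : ℤ, z = (m : ℂ) + (n : ℂ) * τ}

/-- The lattice point `m + nτ` attached to a pair of integers. -/
def latPt (τ : ℂ) (p : ℤ × ℤ) : ℂ := (p.1 : ℂ) + (p.2 : ℂ) * τ

/-- The Weierstrass elliptic function `℘(z|τ)`. -/
def wp (τ z : ℂ) : ℂ :=
  1 / z ^ 2 + ∑' p : {p : ℤ × ℤ // p ≠ 0},
    (1 / (z - latPt τ p.1) ^ 2 - 1 / latPt τ p.1 ^ 2)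

/-- `℘′(z|τ)`. -/
def wpd (τ z : ℂ) : ℂ := deriv (wp τ) z

/-- `℘″(z|τ)`. -/
def wpdd (τ z : ℂ) : ℂ := deriv (deriv (wp τ)) z

/-- The Weierstrass zeta function `ζ(z|τ)` (odd primitive of `-℘`). -/
def wzeta (τ z : ℂ) : ℂ :=
  1 / z + ∑' p : {p : ℤ × ℤ // p ≠ 0},
    (1 / (z - latPt τ p.1) + 1 / latPt τ p.1 + z / latPt τ p.1 ^ 2)

/-- The Weierstrass sigma function `σ(z|τ)`. -/
def wsigma (τ z : ℂ) : ℂ :=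
  z * ∏' p : {p : ℤ × ℤ // p ≠ 0},
    ((1 - z / latPt τ p.1) * Complex.exp (z / latPt τ p.1 + z ^ 2 / (2 * latPt τ p.1 ^ 2)))

/-- The periods `ω₀ = 0, ω₁ = 1, ω₂ = τ, ω₃ = 1 + τ`. -/
def per (τ : ℂ) : ℕ → ℂ
  | 0 => 0
  | 1 => 1
  | 2 => τ
  | 3 => 1 + τ
  | _ => 0

/-- `e_k(τ) = ℘(ω_k/2|τ)`. -/
def eper (τ : ℂ) (k : ℕ) : ℂ := wp τ (per τ k / 2)

/-- The quasi-period `η₁(τ) = 2ζ(1/2|τ)`. -/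
def eta1 (τ : ℂ) : ℂ := 2 * wzeta τ (1 / 2)

/-- The quasi-period `η₂(τ) = 2ζ(τ/2|τ)`. -/
def eta2 (τ : ℂ) : ℂ := 2 * wzeta τ (τ / 2)

/-- `η_k(τ)`, with `η₃ = η₁ + η₂`. -/
def etaq (τ : ℂ) : ℕ → ℂ
  | 1 => eta1 τ
  | 2 => eta2 τ
  | 3 => eta1 τ + eta2 τ
  | _ => 0

/-- The Hecke form `Z(r,s,τ) = ζ(r+sτ|τ) - r η₁(τ) - s η₂(τ)`. -/
def heckeZ (r s τ : ℂ) : ℂ := wzeta τ (r + s * τ) - r * eta1 τ - s * eta2 τ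

/-- The pre-modular form `Z^{(𝐦_k)}(r,s,τ) = Z(r,s,τ)² - ℘(r+sτ|τ) + e_k(τ)`. -/
def heckeZm (k : ℕ) (r s τ : ℂ) : ℂ := heckeZ r s τ ^ 2 - wp τ (r + s * τ) + eper τ k

/-- First component of `(r_k, s_k)`. -/
def rkr (k : ℕ) (r : ℂ) : ℂ := if k = 2 then r else r + 1 / 2

/-- Second component of `(r_k, s_k)`. -/
def rks (k : ℕ) (s : ℂ) : ℂ := if k = 1 then s else s + 1 / 2

/-- `(r,s)` is a half-integer pair, i.e. belongs to `(1/2)ℤ²`. -/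
def IsHalfIntPair (r s : ℂ) : Prop := ∃ m n : ℤ, r = (m : ℂ) / 2 ∧ s = (n : ℂ) / 2

/-- The singular set of the curvature equation: lattice translates of the points `ω_k/2`
with `m_k ≥ 1`. -/
def singSet (τ : ℂ) (m : Fin 4 → ℕ) : Set ℂ :=
  {z | ∃ k : Fin 4, 1 ≤ m k ∧ ∃ l ∈ lat τ, z = per τ (k : ℕ) / 2 + l}

/-- The Laplacian of a real-valued function on `ℂ ≃ ℝ²`. -/
def lapl (u : ℂ → ℝ) (z : ℂ) : ℝ :=
  fderiv ℝ (fun w => fderiv ℝ u w (1 : ℂ)) z (1 : ℂ) +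
  fderiv ℝ (fun w => fderiv ℝ u w Complex.I) z Complex.I

/-- `u` is a solution of the curvature equation `Δu + e^u = 8π Σ m_k δ_{ω_k/2}` on `E_τ`. -/
def IsCurvatureSolution (τ : ℂ) (m : Fin 4 → ℕ) (u : ℂ → ℝ) : Prop :=
  (∀ z, u (z + 1) = u z) ∧ (∀ z, u (z + τ) = u z) ∧
  (∀ z ∉ singSet τ m, (∀ n : ℕ, ContDiffAt ℝ n u z) ∧ lapl u z + Real.exp (u z) = 0) ∧
  (∀ k : Fin 4, 1 ≤ m k → ∀ l ∈ lat τ,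
    ∃ C ε : ℝ, 0 < ε ∧ ∀ z : ℂ, z ≠ per τ (k : ℕ) / 2 + l →
      dist z (per τ (k : ℕ) / 2 + l) < ε →
      |u z - 4 * (m k : ℝ) * Real.log (dist z (per τ (k : ℕ) / 2 + l))| ≤ C)

/-- Multiplicities for equation `(★_k)`: `m₀ = m_k = 1`, the others `0`. -/
def starM (k : ℕ) : Fin 4 → ℕ := fun j => if (j : ℕ) = 0 ∨ (j : ℕ) = k then 1 else 0

/-- `f` is a developing map of `u`: `f` is meromorphic on `ℂ` and
`u = log (8|f′|²/(1+|f|²)²)` wherever `f` is analytic with nonvanishing derivative. -/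
def IsDevelopingMapOf (u : ℂ → ℝ) (f : ℂ → ℂ) : Prop :=
  (∀ z : ℂ, MeromorphicAt f z) ∧
  ∀ z : ℂ, AnalyticAt ℂ f z → deriv f z ≠ 0 →
    u z = Real.log (8 * ‖deriv f z‖ ^ 2 / (1 + ‖f z‖ ^ 2) ^ 2)

/-- `f` satisfies the type II constraint for the torus `E_τ`. -/
def IsTypeII (τ : ℂ) (f : ℂ → ℂ) : Prop :=
  ∃ θ₁ θ₂ : ℝ,
    (∀ z, f (z + 1) = Complex.exp (2 * Complex.I * (θ₁ : ℂ)) * f z) ∧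
    (∀ z, f (z + τ) = Complex.exp (2 * Complex.I * (θ₂ : ℂ)) * f z)

/-- The one-parameter family of solutions generated by the developing map `f`
(with members `u_β` having developing map `e^β f`) contains an even solution. -/
def FamilyHasEven (τ : ℂ) (m : Fin 4 → ℕ) (f : ℂ → ℂ) : Prop :=
  ∃ (β : ℝ) (v : ℂ → ℝ), IsCurvatureSolution τ m v ∧
    IsDevelopingMapOf v (fun z => (Real.exp β : ℂ) * f z) ∧ ∀ z, v (-z) = v z

/-- `u`, with type II developing map `f`, generates a non-even family of solutions. -/
def GeneratesNonEvenFamily (τ : ℂ) (m : Fin 4 → ℕ) (u : ℂ → ℝ) (f : ℂ → ℂ) : Prop :=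
  IsCurvatureSolution τ m u ∧ IsDevelopingMapOf u f ∧ IsTypeII τ f ∧ ¬ FamilyHasEven τ m f

/-- The curvature equation has a non-even family of solutions. -/
def HasNonEvenFamily (τ : ℂ) (m : Fin 4 → ℕ) : Prop :=
  ∃ u f, GeneratesNonEvenFamily τ m u f

/-- The curvature equation has an even family of solutions. -/
def HasEvenFamily (τ : ℂ) (m : Fin 4 → ℕ) : Prop :=
  ∃ (u : ℂ → ℝ) (f : ℂ → ℂ), IsCurvatureSolution τ m u ∧ IsDevelopingMapOf u f ∧
    IsTypeII τ f ∧ FamilyHasEven τ m f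

/-- `y` is a (meromorphic, global) solution of `y″ = q·y` away from the singular set `S`. -/
def SolvesODEOn (q : ℂ → ℂ) (S : Set ℂ) (y : ℂ → ℂ) : Prop :=
  (∀ z : ℂ, MeromorphicAt y z) ∧
  ∀ z ∉ S, AnalyticAt ℂ y z ∧ deriv (deriv y) z = q z * y z

/-- Linear independence of two functions, tested away from the singular set `S`. -/
def LinIndepOn (S : Set ℂ) (y₁ y₂ : ℂ → ℂ) : Prop :=
  ∀ a b : ℂ, (∀ z ∉ S, a * y₁ z + b * y₂ z = 0) → a = 0 ∧ b = 0

/-- The equation `y″ = q·y` (with singular set `S`) on `E_τ` has unitary monodromy: there is a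
fundamental system of solutions whose monodromy matrices w.r.t. `z ↦ z+1` and `z ↦ z+τ`
lie in `SU(2)`. -/
def HasUnitaryMonodromy (q : ℂ → ℂ) (S : Set ℂ) (τ : ℂ) : Prop :=
  ∃ y₁ y₂ : ℂ → ℂ, SolvesODEOn q S y₁ ∧ SolvesODEOn q S y₂ ∧ LinIndepOn S y₁ y₂ ∧
    ∃ M₁ M₂ : Matrix (Fin 2) (Fin 2) ℂ,
      M₁ ∈ Matrix.unitaryGroup (Fin 2) ℂ ∧ M₁.det = 1 ∧
      M₂ ∈ Matrix.unitaryGroup (Fin 2) ℂ ∧ M₂.det = 1 ∧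
      (∀ z, y₁ (z + 1) = M₁ 0 0 * y₁ z + M₁ 0 1 * y₂ z) ∧
      (∀ z, y₂ (z + 1) = M₁ 1 0 * y₁ z + M₁ 1 1 * y₂ z) ∧
      (∀ z, y₁ (z + τ) = M₂ 0 0 * y₁ z + M₂ 0 1 * y₂ z) ∧
      (∀ z, y₂ (z + τ) = M₂ 1 0 * y₁ z + M₂ 1 1 * y₂ z)

/-- The potential of the Fuchsian equation `L(𝐦_k, T, E, τ)`. -/
def LPot (k : ℕ) (T E τ : ℂ) (z : ℂ) : ℂ :=
  2 * wp τ z + 2 * wp τ (z - per τ k / 2) +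
    T * (wzeta τ (z - per τ k / 2) - wzeta τ z) - E

/-- The singular set of `L(𝐦_k, T, E, τ)`: lattice translates of `0` and `ω_k/2`. -/
def LSing (τ : ℂ) (k : ℕ) : Set ℂ := {z | ∃ l ∈ lat τ, z = l ∨ z = per τ k / 2 + l}

/-- The equation `y″ = q·y` is apparent (free of logarithmic singularity) at `p`: there are two
linearly independent single-valued solutions on a punctured neighborhood of `p`, both
meromorphic at `p`. -/
def ApparentAt (q : ℂ → ℂ) (p : ℂ) : Prop :=
  ∃ (y₁ y₂ : ℂ → ℂ) (ε : ℝ), 0 < ε ∧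
    (∀ z ∈ Metric.ball p ε, z ≠ p →
      AnalyticAt ℂ y₁ z ∧ AnalyticAt ℂ y₂ z ∧
      deriv (deriv y₁) z = q z * y₁ z ∧ deriv (deriv y₂) z = q z * y₂ z) ∧
    MeromorphicAt y₁ p ∧ MeromorphicAt y₂ p ∧
    ∀ a b : ℂ, (∀ z ∈ Metric.ball p ε, z ≠ p → a * y₁ z + b * y₂ z = 0) → a = 0 ∧ b = 0

/-- The translated (even) potential `q_k(z;T,E)` of `L(𝐦_k, T, E, τ)`. -/
def qPot (k : ℕ) (T E τ : ℂ) (z : ℂ) : ℂ :=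
  2 * (wp τ (z + per τ k / 4) + wp τ (z - per τ k / 4)) +
    T * (wzeta τ (z + per τ k / 4) - wzeta τ (z - per τ k / 4)) - E

/-- The singular set of the translated potential: lattice translates of `±ω_k/4`. -/
def qSing (τ : ℂ) (k : ℕ) : Set ℂ :=
  {z | ∃ l ∈ lat τ, z = per τ k / 4 + l ∨ z = -(per τ k / 4) + l}

/-- The even elliptic solution `Φ_e(z;T,E)` of the second symmetric product equation. -/
def PhiE (τ : ℂ) (k : ℕ) (T E : ℂ) (z : ℂ) : ℂ :=
  (wpd τ (per τ k / 4)) ^ 4 / (wp τ z - wp τ (per τ k / 4)) ^ 2 +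
  (wpd τ (per τ k / 4)) ^ 2 * (wpd τ (per τ k / 4) * T + wpdd τ (per τ k / 4)) /
      (wp τ z - wp τ (per τ k / 4)) +
  (1 / 4) * (4 * (wpd τ (per τ k / 4)) ^ 2 * E + 3 * (wpd τ (per τ k / 4)) ^ 2 * T ^ 2
    - 8 * wzeta τ (per τ k / 4) * (wpd τ (per τ k / 4)) ^ 2 * T
    + 32 * wp τ (per τ k / 4) * (wpd τ (per τ k / 4)) ^ 2
    - 3 * (wpdd τ (per τ k / 4)) ^ 2)

/-- For `k ∈ {1,2,3}`, the other two indices, so that `{k, i, i′} = {1,2,3}`. -/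
def otherTwo : ℕ → ℕ × ℕ
  | 1 => (2, 3)
  | 2 => (1, 3)
  | 3 => (1, 2)
  | _ => (0, 0)

/-- The Wirtinger derivative `∂_z g = (1/2)(∂_x g - i ∂_y g)`. -/
def wirt (g : ℂ → ℂ) (z : ℂ) : ℂ :=
  (1 / 2) * (fderiv ℝ g z (1 : ℂ) - Complex.I * fderiv ℝ g z Complex.I)

/-- The potential `q(z) = -(1/2)(u_zz - (1/2) u_z²)` associated with a solution `u`. -/
def uPot (u : ℂ → ℝ) (z : ℂ) : ℂ :=
  -(1 / 2) * (wirt (wirt (fun w => ((u w : ℝ) : ℂ))) z -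
    (1 / 2) * (wirt (fun w => ((u w : ℝ) : ℂ)) z) ^ 2)

/-- All lattice translates of the four half-periods. -/
def fullSing (τ : ℂ) : Set ℂ := {z | ∃ k : Fin 4, ∃ l ∈ lat τ, z = per τ (k : ℕ) / 2 + l}

/-- The potential of the general Fuchsian equation (with residues `T₁, T₂, T₃`). -/
def q8 (τ : ℂ) (m : Fin 4 → ℕ) (T₁ T₂ T₃ E : ℂ) (z : ℂ) : ℂ :=
  (∑ k : Fin 4, (m k : ℂ) * ((m k : ℂ) + 1) * wp τ (z - per τ (k : ℕ) / 2)) +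
  T₁ * (wzeta τ (z - per τ 1 / 2) - wzeta τ z) +
  T₂ * (wzeta τ (z - per τ 2 / 2) - wzeta τ z) +
  T₃ * (wzeta τ (z - per τ 3 / 2) - wzeta τ z) - E

/-- The elliptic-of-the-second-kind ansatz built from sigma functions. -/
def sigY (τ : ℂ) (k : ℕ) (a₁ a₂ c : ℂ) (z : ℂ) : ℂ :=
  Complex.exp (c * z) * wsigma τ (z - a₁) * wsigma τ (z - a₂) /
    (wsigma τ (z - per τ k / 4) * wsigma τ (z + per τ k / 4))

end



/-- The period pair `(1, τ)`. -/
noncomputable def mkL (τ : ℂ) (hτ : 0 < τ.im) : PeriodPair where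
  ω₁ := 1
  ω₂ := τ
  indep := by
    rw [LinearIndependent.pair_iff]
    intro s t h
    have him := congrArg Complex.im h
    have hre := congrArg Complex.re h
    simp at him hre
    have ht : t = 0 := him.resolve_right hτ.ne'
    subst ht
    simpa using hre

section basics
variable {τ : ℂ}

lemma mem_lattice_iff (hτ : 0 < τ.im) (z : ℂ) : z ∈ (mkL τ hτ).lattice ↔ z ∈ lat τ := by
  rw [PeriodPair.mem_lattice]
  simp [mkL, lat, eq_comm]

lemma lat_eq (hτ : 0 < τ.im) : lat τ = ((mkL τ hτ).lattice : Set ℂ) := by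
  ext z; exact (mem_lattice_iff hτ z).symm

lemma equiv_apply (hτ : 0 < τ.im) (p : ℤ × ℤ) : ((mkL τ hτ).latticeEquivProd.symm p : ℂ) = latPt τ p := by
  rw [PeriodPair.latticeEquiv_symm_apply]; simp [mkL, latPt]

lemma latPt_mem (p : ℤ × ℤ) : latPt τ p ∈ lat τ := ⟨p.1, p.2, rfl⟩

lemma latPt_ne_zero (hτ : 0 < τ.im) (i : {p : ℤ × ℤ // p ≠ 0}) : latPt τ i.1 ≠ 0 := by
  rw [← equiv_apply hτ]
  simpa using i.2

lemma summable_latPt (hτ : 0 < τ.im) : Summable fun i : {p : ℤ × ℤ // p ≠ 0} => (‖latPt τ i.1‖ ^ 3)⁻¹ := by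
  have h := ZLattice.summable_norm_zpow (mkL τ hτ).lattice (-3) (by simp)
  have h2 := ((mkL τ hτ).latticeEquivProd.symm.toEquiv.summable_iff.mpr h).comp_injective
    (Subtype.val_injective (p := fun p : ℤ × ℤ => p ≠ 0))
  refine h2.congr fun i => ?_
  simp only [Function.comp_apply]
  have : ‖((mkL τ hτ).latticeEquivProd.symm i.1)‖ = ‖latPt τ i.1‖ := by
    rw [← equiv_apply hτ]; rfl
  erw [this]
  rw [zpow_neg]; norm_cast

lemma cofinite_latPt (hτ : 0 < τ.im) (R : ℝ) : ∀ᶠ i : {p : ℤ × ℤ // p ≠ 0} in cofinite, R ≤ ‖latPt τ i.1‖ := by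
  have h := (summable_latPt hτ).tendsto_cofinite_zero
  have hpos : (0 : ℝ) < ((|R| + 1) ^ 3)⁻¹ := by positivity
  filter_upwards [h.eventually (gt_mem_nhds hpos)] with i hi
  have h0 : 0 < ‖latPt τ i.1‖ := norm_pos_iff.mpr (latPt_ne_zero hτ i)
  rw [inv_lt_inv₀ (by positivity) (by positivity)] at hi
  have := lt_of_pow_lt_pow_left₀ 3 h0.le hi
  linarith [le_abs_self R]

lemma wp_eq (hτ : 0 < τ.im) (z : ℂ) : wp τ z = (mkL τ hτ).weierstrassP z := by
  have h := (mkL τ hτ).hasSum_weierstrassP z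
  have h1 := ((mkL τ hτ).latticeEquivProd.symm.toEquiv.hasSum_iff.mpr h)
  have h2 : HasSum (fun p : ℤ × ℤ => 1 / (z - latPt τ p) ^ 2 - 1 / latPt τ p ^ 2)
      ((mkL τ hτ).weierstrassP z) := by
    convert! h1 using 2 with p
    simp only [Function.comp_apply]
    erw [equiv_apply hτ p]
  rw [← h2.tsum_eq, h2.summable.tsum_eq_add_tsum_ite 0, wp]
  congr 1
  · simp [latPt]
  · have := tsum_subtype {p : ℤ × ℤ | p ≠ 0}
      (fun p : ℤ × ℤ => 1 / (z - latPt τ p) ^ 2 - 1 / latPt τ p ^ 2)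
    refine Eq.trans this ?_
    congr 1; ext p
    by_cases hp : p = 0 <;> simp [hp, indicator]

lemma isClosed_lat (hτ : 0 < τ.im) : IsClosed (lat τ) := by
  rw [lat_eq hτ]; exact (mkL τ hτ).isClosed_lattice

lemma isOpen_U (hτ : 0 < τ.im) : IsOpen {z : ℂ | ∀ i : {p : ℤ × ℤ // p ≠ 0}, z ≠ latPt τ i.1} := by
  have : {z : ℂ | ∀ i : {p : ℤ × ℤ // p ≠ 0}, z ≠ latPt τ i.1} = (lat τ \ {0})ᶜ := by
    ext z
    simp only [mem_ofPred_eq, mem_compl_iff, Set.mem_sdiff, mem_singleton_iff, not_and, not_not]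
    constructor
    · rintro h ⟨m, n, rfl⟩
      by_contra hne
      exact h ⟨(m, n), fun h0 => hne (by simp at h0; simp [h0.1, h0.2])⟩ rfl
    · rintro h i rfl
      exact latPt_ne_zero hτ i (h (latPt_mem _))
  rw [this, lat_eq hτ]
  exact (mkL τ hτ).isOpen_compl_lattice_sdiff

lemma lat_countable (τ : ℂ) : (lat τ).Countable := by
  have : lat τ = range (latPt τ) := by
    ext z; simp [lat, latPt, eq_comm]
  rw [this]; exact countable_range _

lemma lat_add {x y : ℂ} (hx : x ∈ lat τ) (hy : y ∈ lat τ) : x + y ∈ lat τ := by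
  obtain ⟨a, b, rfl⟩ := hx
  obtain ⟨c, d, rfl⟩ := hy
  exact ⟨a + c, b + d, by push_cast; ring⟩

lemma lat_neg {x : ℂ} (hx : x ∈ lat τ) : -x ∈ lat τ := by
  obtain ⟨a, b, rfl⟩ := hx
  exact ⟨-a, -b, by push_cast; ring⟩

lemma lat_neg_iff {x : ℂ} : -x ∈ lat τ ↔ x ∈ lat τ :=
  ⟨fun h => by simpa using lat_neg h, lat_neg⟩

lemma lat_add_iff {x y : ℂ} (hy : y ∈ lat τ) : x + y ∈ lat τ ↔ x ∈ lat τ :=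
  ⟨fun h => by simpa using lat_add h (lat_neg hy), fun h => lat_add h hy⟩

lemma lat_zero : (0 : ℂ) ∈ lat τ := ⟨0, 0, by simp⟩

lemma wp_add (hτ : 0 < τ.im) {l : ℂ} (hl : l ∈ lat τ) (z : ℂ) : wp τ (z + l) = wp τ z := by
  rw [wp_eq hτ, wp_eq hτ]
  exact (mkL τ hτ).weierstrassP_add_coe z ⟨l, (mem_lattice_iff hτ l).mpr hl⟩

lemma wp_neg (hτ : 0 < τ.im) (z : ℂ) : wp τ (-z) = wp τ z := by
  rw [wp_eq hτ, wp_eq hτ]; simp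

lemma wp_diff (hτ : 0 < τ.im) {z : ℂ} (hz : z ∉ lat τ) : DifferentiableAt ℂ (wp τ) z := by
  have : wp τ = (mkL τ hτ).weierstrassP := funext (wp_eq hτ)
  rw [this]
  refine ((mkL τ hτ).differentiableOn_weierstrassP).differentiableAt
    ((mkL τ hτ).isClosed_lattice.isOpen_compl.mem_nhds ?_)
  simpa [mem_lattice_iff] using hz

end basics


/-- The index set of nonzero lattice points. -/
abbrev LI := {p : ℤ × ℤ // p ≠ 0}

/-- Regular part of zeta. -/
noncomputable def rz (τ z : ℂ) : ℂ := ∑' p : LI,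
    (1 / (z - latPt τ p.1) + 1 / latPt τ p.1 + z / latPt τ p.1 ^ 2)

/-- Complement of nonzero lattice points. -/
def UU (τ : ℂ) : Set ℂ := {z : ℂ | ∀ i : LI, z ≠ latPt τ i.1}

section zeta
variable {τ : ℂ}

lemma zterm_bound (r : ℝ) (s : ℂ) (hs : ‖s‖ ≤ r) (hr : 0 < r) (l : ℂ) (h : 2 * r ≤ ‖l‖) :
    ‖1 / (s - l) + 1 / l + s / l ^ 2‖ ≤ 2 * r ^ 2 * (‖l‖ ^ 3)⁻¹ := by
  have hl : 0 < ‖l‖ := by linarith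
  have hl0 : l ≠ 0 := norm_pos_iff.mp hl
  have h1 : ‖l‖ / 2 ≤ ‖s - l‖ := by
    have := norm_sub_norm_le l s
    rw [norm_sub_rev] at this
    linarith
  have h2 : 0 < ‖s - l‖ := by linarith
  have hsl : s - l ≠ 0 := norm_pos_iff.mp h2
  have : 1 / (s - l) + 1 / l + s / l ^ 2 = s ^ 2 / (l ^ 2 * (s - l)) := by
    field_simp; ring
  rw [this, norm_div, norm_mul, norm_pow, norm_pow, div_le_iff₀ (by positivity)]
  have e : 2 * r ^ 2 * (‖l‖ ^ 3)⁻¹ * (‖l‖ ^ 2 * (‖l‖ / 2)) = r ^ 2 := by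
    field_simp
  calc ‖s‖ ^ 2 ≤ r ^ 2 := by gcongr
    _ = 2 * r ^ 2 * (‖l‖ ^ 3)⁻¹ * (‖l‖ ^ 2 * (‖l‖ / 2)) := e.symm
    _ ≤ _ := by gcongr

lemma summable_zterm (hτ : 0 < τ.im) (z : ℂ) : Summable fun p : LI =>
    (1 / (z - latPt τ p.1) + 1 / latPt τ p.1 + z / latPt τ p.1 ^ 2) := by
  refine Summable.of_norm_bounded_eventually
    ((summable_latPt hτ).mul_left (2 * (‖z‖ + 1) ^ 2)) ?_
  filter_upwards [cofinite_latPt hτ (2 * (‖z‖ + 1))] with i hi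
  exact zterm_bound (‖z‖ + 1) z (by linarith) (by positivity) _ hi

lemma hasDerivAt_zterm {z l : ℂ} (h : z ≠ l) :
    HasDerivAt (fun z : ℂ => 1 / (z - l) + 1 / l + z / l ^ 2)
      (-(1 / (z - l) ^ 2 - 1 / l ^ 2)) z := by
  have h' : z - l ≠ 0 := sub_ne_zero.mpr h
  have := ((((hasDerivAt_id z).sub_const l).inv h').add_const (1 / l)).add
    ((hasDerivAt_id z).div_const (l ^ 2))
  convert! this using 1
  · ext w; simp
  · simp; ring

lemma hasDerivAt_rz (hτ : 0 < τ.im) {z : ℂ} (hz : z ∈ UU τ) :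
    HasDerivAt (rz τ) (-(wp τ z - 1 / z ^ 2)) z := by
  have hU : IsOpen (UU τ) := isOpen_U hτ
  have hdt : ∀ i : LI, ∀ w ∈ UU τ, HasDerivAt (fun z : ℂ => 1 / (z - latPt τ i.1) + 1 / latPt τ i.1
      + z / latPt τ i.1 ^ 2) (-(1 / (w - latPt τ i.1) ^ 2 - 1 / latPt τ i.1 ^ 2)) w :=
    fun i w hw => hasDerivAt_zterm (hw i)
  have hs1 : SummableLocallyUniformlyOn (fun (i : LI) (z : ℂ) =>
      1 / (z - latPt τ i.1) + 1 / latPt τ i.1 + z / latPt τ i.1 ^ 2) (UU τ) := by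
    refine SummableLocallyUniformlyOn.of_locally_bounded_eventually hU fun K _ hK => ?_
    obtain ⟨r, hr⟩ := hK.isBounded.exists_norm_le
    refine ⟨_, (summable_latPt hτ).mul_left (2 * (|r| + 1) ^ 2), ?_⟩
    filter_upwards [cofinite_latPt hτ (2 * (|r| + 1))] with i hi k hk
    exact zterm_bound (|r| + 1) k (by linarith [hr k hk, le_abs_self r]) (by positivity) _ hi
  have hs2 : SummableLocallyUniformlyOn (fun (i : LI) => derivWithin (fun z : ℂ =>
      1 / (z - latPt τ i.1) + 1 / latPt τ i.1 + z / latPt τ i.1 ^ 2) (UU τ)) (UU τ) := by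
    refine SummableLocallyUniformlyOn.of_locally_bounded_eventually hU fun K hKU hK => ?_
    obtain ⟨r, hr⟩ := hK.isBounded.exists_norm_le
    refine ⟨_, (summable_latPt hτ).mul_left (10 * (|r| + 1)), ?_⟩
    filter_upwards [cofinite_latPt hτ (2 * (|r| + 1))] with i hi k hk
    rw [derivWithin_of_isOpen hU (hKU hk), (hdt i k (hKU hk)).deriv, norm_neg]
    have := PeriodPair.weierstrassP_bound (|r| + 1) (by positivity) k
      (by linarith [hr k hk, le_abs_self r]) _ hi
    convert this using 2
    rw [Real.rpow_neg (norm_nonneg _)]; norm_cast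
  have hd : DifferentiableOn ℂ (rz τ) (UU τ) :=
    hs1.differentiableOn hU (fun i w hw => (hdt i w hw).differentiableAt)
  have h1 := derivWithin_tsum hU hz (fun w _ => summable_zterm hτ w) hs2
    (fun i w hw => (hdt i w hw).differentiableAt)
  have h2 := (hd.differentiableAt (hU.mem_nhds hz)).hasDerivAt
  convert! h2 using 1
  rw [derivWithin_of_isOpen hU hz] at h1
  refine Eq.trans ?_ h1.symm
  rw [wp, add_sub_cancel_left, ← tsum_neg]
  refine tsum_congr fun i => ?_
  rw [derivWithin_of_isOpen hU hz, (hdt i z hz).deriv]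

lemma rz_neg (z : ℂ) : rz τ (-z) = - rz τ z := by
  let e : LI ≃ LI := ⟨fun i => ⟨-i.1, by simpa using i.2⟩, fun j => ⟨-j.1, by simpa using j.2⟩,
    fun _ => by simp, fun _ => by simp⟩
  rw [rz, ← e.tsum_eq, rz, ← tsum_neg]
  refine tsum_congr fun i => ?_
  have : latPt τ (e i).1 = - latPt τ i.1 := by simp [e, latPt]; ring
  rw [this]
  have h : -z - -latPt τ i.1 = -(z - latPt τ i.1) := by ring
  rw [h, neg_sq, one_div, one_div, one_div, one_div, inv_neg, inv_neg]; ring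

lemma rz_zero : rz τ 0 = 0 := by
  have := rz_neg (τ := τ) 0
  rw [neg_zero] at this
  exact self_eq_neg.mp this

lemma wzeta_eq (z : ℂ) : wzeta τ z = 1 / z + rz τ z := rfl

lemma wzeta_neg (z : ℂ) : wzeta τ (-z) = - wzeta τ z := by
  rw [wzeta_eq, wzeta_eq, rz_neg]; simp [inv_neg]; ring

lemma zero_mem_UU (hτ : 0 < τ.im) : (0 : ℂ) ∈ UU τ := fun i => (latPt_ne_zero hτ i).symm

lemma mem_UU {z : ℂ} (hz : z ∉ lat τ) : z ∈ UU τ := fun i h => hz (h ▸ latPt_mem _)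

lemma hasDerivAt_wzeta (hτ : 0 < τ.im) {z : ℂ} (hz : z ∉ lat τ) :
    HasDerivAt (wzeta τ) (-wp τ z) z := by
  have hz0 : z ≠ 0 := fun h => hz (h ▸ lat_zero)
  have := (hasDerivAt_inv hz0).add (hasDerivAt_rz hτ (mem_UU hz))
  convert! this using 1
  · ext w; simp [wzeta_eq]
  · simp only [one_div]; ring

lemma wzeta_quasi (hτ : 0 < τ.im) {l : ℂ} (hl : l ∈ lat τ) :
    ∃ C, ∀ z ∉ lat τ, wzeta τ (z + l) = wzeta τ z + C := by
  have hc : IsPreconnected (lat τ)ᶜ :=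
    ((lat_countable τ).isConnected_compl_of_one_lt_rank (by simp)).isPreconnected
  have hd : ∀ z ∈ (lat τ)ᶜ, HasDerivAt (fun z => wzeta τ (z + l) - wzeta τ z) 0 z := by
    intro z hz
    have h1 := (hasDerivAt_wzeta hτ (z := z + l) (by rwa [lat_add_iff hl])).comp_add_const z l
    have := h1.sub (hasDerivAt_wzeta hτ hz)
    rwa [wp_add hτ hl, sub_self] at this
  obtain ⟨C, hC⟩ := (isClosed_lat hτ).isOpen_compl.exists_is_const_of_deriv_eq_zero hc
    (fun z hz => (hd z hz).differentiableAt.differentiableWithinAt) (fun z hz => (hd z hz).deriv)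
  exact ⟨C, fun z hz => by rw [← hC z hz]; ring⟩

lemma wzeta_quasi_half (hτ : 0 < τ.im) {l : ℂ} (hl : l ∈ lat τ) (hl2 : l / 2 ∉ lat τ) :
    ∀ z ∉ lat τ, wzeta τ (z + l) = wzeta τ z + 2 * wzeta τ (l / 2) := by
  obtain ⟨C, hC⟩ := wzeta_quasi hτ hl
  have h := hC (-(l / 2)) (by rwa [lat_neg_iff])
  rw [show -(l / 2) + l = l / 2 by ring, wzeta_neg] at h
  intro z hz
  rw [hC z hz]; linear_combination -h

end zeta


section addition
variable {τ : ℂ}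

lemma lat_punct (hτ : 0 < τ.im) (c : ℂ) : ∀ᶠ z in 𝓝[≠] c, z ∉ lat τ := by
  have := (mkL τ hτ).compl_lattice_sdiff_singleton_mem_nhds c
  filter_upwards [self_mem_nhdsWithin, mem_nhdsWithin_of_mem_nhds this] with z hz hz2 hzl
  exact hz2 ⟨(mem_lattice_iff hτ z).mpr hzl, hz⟩

lemma lat_punct_add (hτ : 0 < τ.im) (c y : ℂ) : ∀ᶠ z in 𝓝[≠] c, z + y ∉ lat τ := by
  have h : Tendsto (fun z => z + y) (𝓝[≠] c) (𝓝[≠] (c + y)) := by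
    refine tendsto_nhdsWithin_of_tendsto_nhds_of_eventually_within _ ?_ ?_
    · exact ((continuous_id.add continuous_const).tendsto c).mono_left nhdsWithin_le_nhds
    · filter_upwards [self_mem_nhdsWithin] with z hz
      simpa using hz
  exact h.eventually (lat_punct hτ (c + y))

lemma wp_zero (hτ : 0 < τ.im) : wp τ 0 = 0 := by rw [wp_eq hτ]; simp

lemma tendsto_pz (hτ : 0 < τ.im) : Tendsto (fun x => wp τ x - 1 / x ^ 2) (𝓝 0) (𝓝 0) := by
  have hU : IsOpen (UU τ) := isOpen_U hτ
  have hd : DifferentiableOn ℂ (rz τ) (UU τ) := fun z hz =>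
    (hasDerivAt_rz hτ hz).differentiableAt.differentiableWithinAt
  have hm := hU.mem_nhds (zero_mem_UU hτ)
  have hc : ContinuousAt (deriv (rz τ)) 0 := ((hd.analyticAt hm).deriv).continuousAt
  have h0 : deriv (rz τ) 0 = 0 := by
    rw [(hasDerivAt_rz hτ (zero_mem_UU hτ)).deriv, wp_zero hτ]; simp
  have h1 : Tendsto (fun x => - deriv (rz τ) x) (𝓝 0) (𝓝 0) := by
    have := hc.neg.tendsto
    rw [Pi.neg_apply, h0, neg_zero] at this
    exact this
  refine h1.congr' ?_
  filter_upwards [hm] with z hz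
  rw [(hasDerivAt_rz hτ hz).deriv]; ring

/-- Defect of the addition theorem. -/
noncomputable def AA (τ y x : ℂ) : ℂ :=
  (wzeta τ x + wzeta τ y - wzeta τ (x + y)) ^ 2 - wp τ x - wp τ y - wp τ (x + y)

lemma AA_lim (hτ : 0 < τ.im) {y : ℂ} (hy : y ∉ lat τ) : Tendsto (AA τ y) (𝓝[≠] 0) (𝓝 0) := by
  have hg : HasDerivAt (fun x => rz τ x + wzeta τ y - wzeta τ (x + y)) (wp τ y) 0 := by
    have h1 := hasDerivAt_rz hτ (zero_mem_UU hτ)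
    have h2 := (hasDerivAt_wzeta hτ (z := 0 + y) (by simpa using hy)).comp_add_const 0 y
    have := (h1.add_const (wzeta τ y)).sub h2
    convert! this using 1
    simp [wp_zero hτ]
  have hs := hg.tendsto_slope
  have hgc : Tendsto (fun x => rz τ x + wzeta τ y - wzeta τ (x + y)) (𝓝[≠] 0) (𝓝 0) := by
    have := hg.continuousAt.tendsto.mono_left (nhdsWithin_le_nhds (s := {0}ᶜ))
    simpa [rz_zero] using this
  have hp := (tendsto_pz hτ).mono_left (nhdsWithin_le_nhds (s := {0}ᶜ))
  have hpy : Tendsto (fun x => wp τ (x + y)) (𝓝[≠] 0) (𝓝 (wp τ y)) := by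
    have h1 : ContinuousAt (wp τ) (0 + y) := (wp_diff hτ (by simpa using hy)).continuousAt
    have h2 : ContinuousAt (fun x => wp τ (x + y)) 0 :=
      ContinuousAt.comp (f := fun x : ℂ => x + y) h1 (by fun_prop)
    simpa using h2.tendsto.mono_left (nhdsWithin_le_nhds (s := {0}ᶜ))
  have := ((((hs.const_mul 2).add (hgc.pow 2)).sub hp).sub_const (wp τ y)).sub hpy
  have e : 2 * wp τ y + 0 ^ 2 - 0 - wp τ y - wp τ y = 0 := by ring
  rw [e] at this
  refine this.congr' ?_
  filter_upwards [self_mem_nhdsWithin] with x hx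
  have hx0 : x ≠ 0 := hx
  simp only [AA, slope, wzeta_eq (τ := τ) x, rz_zero, zero_add, vsub_eq_sub, sub_self, smul_eq_mul,
    sub_zero]
  field_simp
  ring

lemma AA_symm (hτ : 0 < τ.im) (y x : ℂ) : AA τ y (-x - y) = AA τ y x := by
  have h1 : -x - y = -(x + y) := by ring
  have h2 : -(x + y) + y = -x := by ring
  rw [AA, AA, h1, h2, wzeta_neg, wzeta_neg, wp_neg hτ, wp_neg hτ]; ring

lemma AA_per (hτ : 0 < τ.im) {y x l : ℂ} (hl : l ∈ lat τ) (hx : x ∉ lat τ) (hxy : x + y ∉ lat τ) :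
    AA τ y (x + l) = AA τ y x := by
  obtain ⟨C, hC⟩ := wzeta_quasi hτ hl
  have h1 : x + l + y = x + y + l := by ring
  rw [AA, AA, h1, hC x hx, hC _ hxy, wp_add hτ hl, wp_add hτ hl]; ring

open Classical in
/-- Extension by zero of the defect. -/
noncomputable def FF (τ y x : ℂ) : ℂ := if x ∈ lat τ ∨ x + y ∈ lat τ then 0 else AA τ y x

lemma FF_symm (hτ : 0 < τ.im) (y x : ℂ) : FF τ y (-x - y) = FF τ y x := by
  have h1 : -x - y = -(x + y) := by ring
  have h2 : -(x + y) + y = -x := by ring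
  unfold FF
  rw [AA_symm hτ, h1, h2, lat_neg_iff, lat_neg_iff]
  by_cases ha : x ∈ lat τ <;> by_cases hb : x + y ∈ lat τ <;> simp [ha, hb]

lemma FF_per (hτ : 0 < τ.im) (y x : ℂ) {l : ℂ} (hl : l ∈ lat τ) :
    FF τ y (x + l) = FF τ y x := by
  unfold FF
  have h1 : x + l + y = x + y + l := by ring
  rw [h1, lat_add_iff hl, lat_add_iff hl]
  split_ifs with h
  · rfl
  · push Not at h
    exact AA_per hτ hl h.1 h.2

lemma FF_cont0 (hτ : 0 < τ.im) {y : ℂ} (hy : y ∉ lat τ) : ContinuousAt (FF τ y) 0 := by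
  rw [continuousAt_iff_punctured_nhds]
  have h0 : FF τ y 0 = 0 := by simp [FF, lat_zero]
  rw [h0]
  refine (AA_lim hτ hy).congr' ?_
  filter_upwards [lat_punct hτ 0, lat_punct_add hτ 0 y] with x h1 h2
  simp [FF, h1, h2]

lemma FF_cont (hτ : 0 < τ.im) {y : ℂ} (hy : y ∉ lat τ) {s : ℂ} (hs : s ∈ lat τ) :
    ContinuousAt (FF τ y) s := by
  have : FF τ y = fun x => FF τ y (x + -s) := by
    ext x; rw [FF_per hτ _ _ (lat_neg hs)]
  rw [this]
  have h0 : ContinuousAt (FF τ y) (s + -s) := by simpa using FF_cont0 hτ hy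
  exact ContinuousAt.comp (f := fun x : ℂ => x + -s) h0 (by fun_prop)

lemma FF_cont' (hτ : 0 < τ.im) {y : ℂ} (hy : y ∉ lat τ) {s : ℂ} (hs : s + y ∈ lat τ) :
    ContinuousAt (FF τ y) s := by
  have : FF τ y = fun x => FF τ y (-x - y) := by
    ext x; rw [FF_symm hτ]
  rw [this]
  have h0 : ContinuousAt (FF τ y) (-s - y) := FF_cont hτ hy (by
    rw [show -s - y = -(s + y) by ring]; exact lat_neg hs)
  exact ContinuousAt.comp (f := fun x : ℂ => -x - y) h0 (by fun_prop)

lemma FF_diff_off (hτ : 0 < τ.im) {y x : ℂ} (h1 : x ∉ lat τ) (h2 : x + y ∉ lat τ) :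
    DifferentiableAt ℂ (FF τ y) x := by
  have hA : DifferentiableAt ℂ (AA τ y) x := by
    have a1 := (hasDerivAt_wzeta hτ h1).differentiableAt
    have a2 := ((hasDerivAt_wzeta hτ h2).comp_add_const x y).differentiableAt
    have a3 := wp_diff hτ h1
    have a4 : DifferentiableAt ℂ (fun x => wp τ (x + y)) x :=
      ((wp_diff hτ h2).hasDerivAt.comp_add_const x y).differentiableAt
    exact (((((a1.add_const _).sub a2).pow 2).sub a3).sub_const _).sub a4
  refine hA.congr_of_eventuallyEq ?_
  have o1 := (isClosed_lat hτ).isOpen_compl.mem_nhds h1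
  have o2 : ∀ᶠ z in 𝓝 x, z + y ∈ (lat τ)ᶜ :=
    (continuous_id.add continuous_const).continuousAt.eventually
      ((isClosed_lat hτ).isOpen_compl.mem_nhds h2)
  filter_upwards [o1, o2] with z hz1 hz2
  simp only [mem_compl_iff] at hz1 hz2
  simp [FF, hz1, hz2]

lemma FF_diff (hτ : 0 < τ.im) {y : ℂ} (hy : y ∉ lat τ) : Differentiable ℂ (FF τ y) := by
  intro c
  have hp : ∀ᶠ z in 𝓝[≠] c, DifferentiableAt ℂ (FF τ y) z := by
    filter_upwards [lat_punct hτ c, lat_punct_add hτ c y] with z h1 h2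
    exact FF_diff_off hτ h1 h2
  by_cases h1 : c ∈ lat τ
  · exact (Complex.analyticAt_of_differentiable_on_punctured_nhds_of_continuousAt hp
      (FF_cont hτ hy h1)).differentiableAt
  by_cases h2 : c + y ∈ lat τ
  · exact (Complex.analyticAt_of_differentiable_on_punctured_nhds_of_continuousAt hp
      (FF_cont' hτ hy h2)).differentiableAt
  exact FF_diff_off hτ h1 h2

lemma wzeta_addition (hτ : 0 < τ.im) {x y : ℂ} (hx : x ∉ lat τ) (hy : y ∉ lat τ)
    (hxy : x + y ∉ lat τ) :
    (wzeta τ x + wzeta τ y - wzeta τ (x + y)) ^ 2 = wp τ x + wp τ y + wp τ (x + y) := by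
  have hd := FF_diff hτ hy
  have := hd.apply_eq_apply_of_bounded (IsZLattice.isCompact_range_of_periodic (mkL τ hτ).lattice _
    hd.continuous fun z w hw => FF_per hτ y z ((mem_lattice_iff hτ w).mp hw)).isBounded x 0
  have h0 : FF τ y 0 = 0 := by simp [FF, lat_zero]
  rw [h0, FF, if_neg (by tauto), AA] at this
  linear_combination this

/-- Addition theorem in difference form. -/
lemma wzeta_sub (hτ : 0 < τ.im) {z a b : ℂ} (ha : z - a ∉ lat τ) (hb : z - b ∉ lat τ)
    (hab : a - b ∉ lat τ) :
    (wzeta τ (z - a) - wzeta τ (z - b) + wzeta τ (a - b)) ^ 2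
      = wp τ (z - a) + wp τ (z - b) + wp τ (a - b) := by
  have h := wzeta_addition hτ ha hab (by simpa using hb)
  rw [show z - a + (a - b) = z - b by ring] at h
  linear_combination h

end addition


/-- Factor of the sigma product. -/
noncomputable def sfac (τ : ℂ) (i : LI) (z : ℂ) : ℂ :=
  (1 - z / latPt τ i.1) * Complex.exp (z / latPt τ i.1 + z ^ 2 / (2 * latPt τ i.1 ^ 2))

section sigma
variable {τ : ℂ}

lemma efac_bound {w : ℂ} (hw : ‖w‖ ≤ 1 / 2) :
    ‖(1 - w) * Complex.exp (w + w ^ 2 / 2) - 1‖ ≤ 2 * ‖w‖ ^ 3 := by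
  have h1 := Complex.norm_log_sub_logTaylor_le 2 (z := -w) (by rw [norm_neg]; linarith)
  have ht : Complex.logTaylor (2 + 1) (-w) = -w - w ^ 2 / 2 := by
    simp [Complex.logTaylor_succ, Complex.logTaylor_zero]; ring
  rw [ht, norm_neg] at h1
  set δ := Complex.log (1 + -w) - (-w - w ^ 2 / 2) with hδ
  have hw1 : (1 + -w) ≠ 0 := by
    intro h
    have : w = 1 := by linear_combination -h
    rw [this] at hw; norm_num at hw
  have hexp : (1 - w) * Complex.exp (w + w ^ 2 / 2) = Complex.exp δ := by
    have : δ = Complex.log (1 + -w) + (w + w ^ 2 / 2) := by rw [hδ]; ring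
    rw [this, Complex.exp_add (Complex.log _), Complex.exp_log hw1]; ring
  have hn := norm_nonneg w
  have h2 : (1 - ‖w‖)⁻¹ ≤ 2 := by
    rw [inv_le_comm₀ (by linarith) (by norm_num)]; linarith
  have h3 : ‖δ‖ ≤ ‖w‖ ^ 3 := by
    calc ‖δ‖ ≤ _ := h1
      _ ≤ ‖w‖ ^ (2 + 1) * 2 / ((2 : ℕ) + 1) := by gcongr
      _ ≤ ‖w‖ ^ 3 := by
        norm_num
        nlinarith [pow_nonneg hn 3]
  have h4 : ‖w‖ ^ 3 ≤ 1 := pow_le_one₀ hn (by linarith)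
  rw [hexp]
  calc _ ≤ 2 * ‖δ‖ := Complex.norm_exp_sub_one_le (h3.trans h4)
    _ ≤ _ := by gcongr

lemma sfac_bound (i : LI) {r : ℝ} (hr : 0 < r) {z : ℂ} (hz : ‖z‖ ≤ r) (h : 2 * r ≤ ‖latPt τ i.1‖) :
    ‖sfac τ i z - 1‖ ≤ 2 * r ^ 3 * (‖latPt τ i.1‖ ^ 3)⁻¹ := by
  have hl : 0 < ‖latPt τ i.1‖ := by linarith
  have hw : ‖z / latPt τ i.1‖ ≤ 1 / 2 := by
    rw [norm_div, div_le_iff₀ hl]; linarith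
  have := efac_bound hw
  have e : sfac τ i z = (1 - z / latPt τ i.1) *
      Complex.exp (z / latPt τ i.1 + (z / latPt τ i.1) ^ 2 / 2) := by
    rw [sfac]; congr 3; rw [div_pow, div_div, mul_comm]
  rw [e]
  refine this.trans ?_
  rw [norm_div, div_pow, mul_assoc, ← div_eq_mul_inv]
  gcongr

lemma sfac_diff (i : LI) : Differentiable ℂ (sfac τ i) := by
  unfold sfac
  fun_prop

lemma sfac_mult (hτ : 0 < τ.im) (r : ℝ) :
    MultipliableLocallyUniformlyOn (sfac τ) (ball 0 r) := by
  have h := Summable.multipliableLocallyUniformlyOn_one_add (f := fun (i : LI) z => sfac τ i z - 1)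
    (K := ball (0 : ℂ) r) isOpen_ball ((summable_latPt hτ).mul_left (2 * (|r| + 1) ^ 3)) ?_ ?_
  · convert h using 3
    ring
  · filter_upwards [cofinite_latPt hτ (2 * (|r| + 1))] with i hi z hz
    refine sfac_bound i (by positivity) ?_ hi
    have := mem_ball_zero_iff.mp hz
    linarith [le_abs_self r]
  · intro i
    exact ((sfac_diff i).continuous.sub continuous_const).continuousOn

/-- The regular part of sigma. -/
noncomputable def sP (τ z : ℂ) : ℂ := ∏' i : LI, sfac τ i z

lemma sP_diff (hτ : 0 < τ.im) : Differentiable ℂ (sP τ) := by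
  intro z
  have h := (sfac_mult hτ (‖z‖ + 1)).hasProdLocallyUniformlyOn
  have h2 := (hasProdLocallyUniformlyOn_iff_tendstoLocallyUniformlyOn.mp h).differentiableOn
    (.of_forall fun s => (DifferentiableOn.fun_finsetProd
      fun i _ => (sfac_diff i).differentiableOn)) isOpen_ball
  exact h2.differentiableAt (isOpen_ball.mem_nhds (by simp))

lemma sfac_ne {i : LI} (hτ : 0 < τ.im) {z : ℂ} (hz : z ∈ UU τ) : sfac τ i z ≠ 0 := by
  refine mul_ne_zero ?_ (Complex.exp_ne_zero _)
  intro h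
  have hl := latPt_ne_zero hτ i
  refine hz i ?_
  field_simp at h
  linear_combination -h

lemma sP_ne (hτ : 0 < τ.im) {z : ℂ} (hz : z ∈ UU τ) : sP τ z ≠ 0 := by
  have := tprod_one_add_ne_zero_of_summable (f := fun i : LI => sfac τ i z - 1)
    (fun i => by simpa using sfac_ne hτ hz) ?_
  · simpa [sP] using this
  · refine Summable.of_norm_bounded_eventually
      ((summable_latPt hτ).mul_left (2 * (‖z‖ + 1) ^ 3)) ?_
    filter_upwards [cofinite_latPt hτ (2 * (‖z‖ + 1))] with i hi
    rw [norm_norm]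
    exact sfac_bound i (by positivity) (by linarith) hi

lemma sfac_logDeriv (hτ : 0 < τ.im) (i : LI) {z : ℂ} (hz : z ∈ UU τ) :
    logDeriv (sfac τ i) z = 1 / (z - latPt τ i.1) + 1 / latPt τ i.1 + z / latPt τ i.1 ^ 2 := by
  have hl := latPt_ne_zero hτ i
  have hzl : z - latPt τ i.1 ≠ 0 := sub_ne_zero.mpr (hz i)
  have hd : HasDerivAt (sfac τ i) (-(1 / latPt τ i.1) * Complex.exp (z / latPt τ i.1 + z ^ 2 / (2 * latPt τ i.1 ^ 2)) +
      (1 - z / latPt τ i.1) * (Complex.exp (z / latPt τ i.1 + z ^ 2 / (2 * latPt τ i.1 ^ 2)) *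
        (1 / latPt τ i.1 + z / latPt τ i.1 ^ 2))) z := by
    have h1 := ((hasDerivAt_id z).div_const (latPt τ i.1)).const_sub 1
    have h2 := (((hasDerivAt_id z).div_const (latPt τ i.1)).add
      ((hasDerivAt_pow 2 z).div_const (2 * latPt τ i.1 ^ 2))).cexp
    convert! h1.mul h2 using 1
    simp
    left
    field_simp
  have hne := sfac_ne (i := i) hτ hz
  have h1 : 1 - z / latPt τ i.1 ≠ 0 := left_ne_zero_of_mul hne
  have h1' : latPt τ i.1 - z ≠ 0 := fun h => hzl (by linear_combination -h)
  rw [logDeriv_apply, hd.deriv, sfac]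
  have hE := Complex.exp_ne_zero (z / latPt τ i.1 + z ^ 2 / (2 * latPt τ i.1 ^ 2))
  set E := Complex.exp (z / latPt τ i.1 + z ^ 2 / (2 * latPt τ i.1 ^ 2))
  have e1 : 1 - z / latPt τ i.1 = (latPt τ i.1 - z) / latPt τ i.1 := by field_simp
  have e2 : 1 / (z - latPt τ i.1) = - (1 / (latPt τ i.1 - z)) := by
    rw [← neg_sub, one_div, one_div, inv_neg]
  rw [e1, e2, div_eq_iff (mul_ne_zero (div_ne_zero h1' hl) hE)]
  field_simp
  ring

lemma hasDerivAt_sP (hτ : 0 < τ.im) {z : ℂ} (hz : z ∈ UU τ) :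
    HasDerivAt (sP τ) (sP τ z * rz τ z) z := by
  have h := logDeriv_tprod_eq_tsum (f := sfac τ) isOpen_ball (x := z) (s := ball 0 (‖z‖ + 1))
    (by simp) (fun i => sfac_ne hτ hz) (fun i => (sfac_diff i).differentiableOn)
    ((summable_zterm hτ z).congr fun i => (sfac_logDeriv hτ i hz).symm)
    (sfac_mult hτ _) (sP_ne hτ hz)
  have h2 : logDeriv (sP τ) z = rz τ z :=
    h.trans (tsum_congr fun i => sfac_logDeriv hτ i hz)
  rw [logDeriv_apply, div_eq_iff (sP_ne hτ hz)] at h2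
  have := (sP_diff hτ z).hasDerivAt
  rwa [h2, mul_comm] at this

lemma wsigma_eq (z : ℂ) : wsigma τ z = z * sP τ z := rfl

lemma wsigma_diff (hτ : 0 < τ.im) : Differentiable ℂ (wsigma τ) :=
  differentiable_id.mul (sP_diff hτ)

lemma wsigma_ne (hτ : 0 < τ.im) {z : ℂ} (hz : z ∉ lat τ) : wsigma τ z ≠ 0 :=
  mul_ne_zero (fun h => hz (h ▸ lat_zero)) (sP_ne hτ (mem_UU hz))

lemma hasDerivAt_wsigma (hτ : 0 < τ.im) {z : ℂ} (hz : z ∉ lat τ) :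
    HasDerivAt (wsigma τ) (wsigma τ z * wzeta τ z) z := by
  have hz0 : z ≠ 0 := fun h => hz (h ▸ lat_zero)
  have := (hasDerivAt_id z).mul (hasDerivAt_sP hτ (mem_UU hz))
  convert! this using 1
  rw [wsigma_eq, wzeta_eq, id]
  field_simp

end sigma


section main
variable {τ : ℂ}

/-- The ansatz with generic `p`. -/
noncomputable def YY (τ p a b c z : ℂ) : ℂ :=
  Complex.exp (c * z) * wsigma τ (z - a) * wsigma τ (z - b) /
    (wsigma τ (z - p) * wsigma τ (z + p))

/-- Its logarithmic derivative. -/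
noncomputable def uu (τ p a b c z : ℂ) : ℂ :=
  c + wzeta τ (z - a) + wzeta τ (z - b) - wzeta τ (z - p) - wzeta τ (z + p)

/-- Points away from zeros and poles. -/
def Good (τ p a b z : ℂ) : Prop :=
  z - a ∉ lat τ ∧ z - b ∉ lat τ ∧ z - p ∉ lat τ ∧ z + p ∉ lat τ

lemma lat_near (hτ : 0 < τ.im) {z y : ℂ} (h : z + y ∉ lat τ) : ∀ᶠ w in 𝓝 z, w + y ∉ lat τ :=
  (continuous_id.add continuous_const).continuousAt.eventually
      ((isClosed_lat hτ).isOpen_compl.mem_nhds h)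

lemma lat_near_sub (hτ : 0 < τ.im) {z y : ℂ} (h : z - y ∉ lat τ) : ∀ᶠ w in 𝓝 z, w - y ∉ lat τ := by
  simp only [sub_eq_add_neg] at *
  exact lat_near hτ h

lemma lat_punct_sub (hτ : 0 < τ.im) (c y : ℂ) : ∀ᶠ z in 𝓝[≠] c, z - y ∉ lat τ := by
  simp only [sub_eq_add_neg]
  exact lat_punct_add hτ c (-y)

lemma Good_near (hτ : 0 < τ.im) {p a b z : ℂ} (h : Good τ p a b z) :
    ∀ᶠ w in 𝓝 z, Good τ p a b w :=
  (lat_near_sub hτ h.1).and ((lat_near_sub hτ h.2.1).and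
    ((lat_near_sub hτ h.2.2.1).and (lat_near hτ h.2.2.2)))

lemma Good_punct (hτ : 0 < τ.im) (p a b z : ℂ) :
    ∀ᶠ w in 𝓝[≠] z, Good τ p a b w :=
  (lat_punct_sub hτ z a).and ((lat_punct_sub hτ z b).and
    ((lat_punct_sub hτ z p).and (lat_punct_add hτ z p)))

lemma YY_ne (hτ : 0 < τ.im) {p a b c z : ℂ} (h : Good τ p a b z) : YY τ p a b c z ≠ 0 := by
  unfold YY
  exact div_ne_zero (mul_ne_zero (mul_ne_zero (Complex.exp_ne_zero _) (wsigma_ne hτ h.1))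
    (wsigma_ne hτ h.2.1)) (mul_ne_zero (wsigma_ne hτ h.2.2.1) (wsigma_ne hτ h.2.2.2))

lemma YY_deriv (hτ : 0 < τ.im) {p a b c z : ℂ} (h : Good τ p a b z) :
    HasDerivAt (YY τ p a b c) (uu τ p a b c z * YY τ p a b c z) z := by
  have d0 : HasDerivAt (fun z => Complex.exp (c * z)) (Complex.exp (c * z) * (c * 1)) z :=
    ((hasDerivAt_id z).const_mul c).cexp
  have d1 := (hasDerivAt_wsigma hτ h.1).comp_sub_const z a
  have d2 := (hasDerivAt_wsigma hτ h.2.1).comp_sub_const z b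
  have d3 := (hasDerivAt_wsigma hτ h.2.2.1).comp_sub_const z p
  have d4 := (hasDerivAt_wsigma hτ h.2.2.2).comp_add_const z p
  have n3 := wsigma_ne hτ h.2.2.1
  have n4 := wsigma_ne hτ h.2.2.2
  have := ((d0.mul d1).mul d2).div (d3.mul d4) (mul_ne_zero n3 n4)
  convert! this using 1
  simp only [uu, YY, Pi.mul_apply]
  field_simp
  ring

/-- derivative of `uu`. -/
noncomputable def vv (τ p a b z : ℂ) : ℂ :=
  - wp τ (z - a) - wp τ (z - b) + wp τ (z - p) + wp τ (z + p)

lemma uu_deriv (hτ : 0 < τ.im) {p a b c z : ℂ} (h : Good τ p a b z) :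
    HasDerivAt (uu τ p a b c) (vv τ p a b z) z := by
  have d1 := (hasDerivAt_wzeta hτ h.1).comp_sub_const z a
  have d2 := (hasDerivAt_wzeta hτ h.2.1).comp_sub_const z b
  have d3 := (hasDerivAt_wzeta hτ h.2.2.1).comp_sub_const z p
  have d4 := (hasDerivAt_wzeta hτ h.2.2.2).comp_add_const z p
  have := (((d1.const_add c).add d2).sub d3).sub d4
  convert! this using 1
  simp only [vv]
  ring

lemma YY_deriv2 (hτ : 0 < τ.im) {p a b c z : ℂ} (h : Good τ p a b z) :
    deriv (deriv (YY τ p a b c)) z = (vv τ p a b z + uu τ p a b c z ^ 2) * YY τ p a b c z := by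
  have e : deriv (YY τ p a b c) =ᶠ[𝓝 z] fun w => uu τ p a b c w * YY τ p a b c w := by
    filter_upwards [Good_near hτ h] with w hw
    exact (YY_deriv hτ hw).deriv
  rw [e.deriv_eq]
  have := (uu_deriv (c := c) hτ h).mul (YY_deriv (c := c) hτ h)
  have h2 := this.deriv
  rw [show (fun w => uu τ p a b c w * YY τ p a b c w) = uu τ p a b c * YY τ p a b c from rfl, h2]
  ring

/-- constant term -/
noncomputable def KK (τ p a b c : ℂ) : ℂ :=
  c ^ 2 + (wzeta τ (a - b) ^ 2 - wp τ (a - b)) + (wzeta τ (p + p) ^ 2 - wp τ (p + p))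
   - (wzeta τ (a - p) ^ 2 - wp τ (a - p)) - (wzeta τ (a + p) ^ 2 - wp τ (a + p))
   - (wzeta τ (b - p) ^ 2 - wp τ (b - p)) - (wzeta τ (b + p) ^ 2 - wp τ (b + p))

/-- Nondegeneracy hypotheses. -/
structure Hyp (τ p a b : ℂ) : Prop where
  ab : a - b ∉ lat τ
  pp : p + p ∉ lat τ
  am : a - p ∉ lat τ
  ap : a + p ∉ lat τ
  bm : b - p ∉ lat τ
  bp : b + p ∉ lat τ

lemma wzeta_sub' (hτ : 0 < τ.im) {z a b : ℂ} (ha : z - a ∉ lat τ) (hb : z + b ∉ lat τ)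
    (hab : a + b ∉ lat τ) :
    (wzeta τ (z - a) - wzeta τ (z + b) + wzeta τ (a + b)) ^ 2
      = wp τ (z - a) + wp τ (z + b) + wp τ (a + b) := by
  have := wzeta_sub (τ := τ) (z := z) (a := a) (b := -b) hτ ha (by simpa using hb)
    (by simpa using hab)
  simpa only [sub_neg_eq_add] using this

lemma key (hτ : 0 < τ.im) {p a b c z : ℂ} (H : Hyp τ p a b) (h : Good τ p a b z) :
    vv τ p a b z + uu τ p a b c z ^ 2 = 2 * wp τ (z - p) + 2 * wp τ (z + p)
      + 2 * (c + wzeta τ (a - b) - wzeta τ (a - p) - wzeta τ (a + p)) * wzeta τ (z - a)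
      + 2 * (c - wzeta τ (a - b) - wzeta τ (b - p) - wzeta τ (b + p)) * wzeta τ (z - b)
      - 2 * (c - wzeta τ (a - p) - wzeta τ (b - p) - wzeta τ (p + p)) * wzeta τ (z - p)
      - 2 * (c - wzeta τ (a + p) - wzeta τ (b + p) + wzeta τ (p + p)) * wzeta τ (z + p)
      + KK τ p a b c := by
  have e1 := wzeta_sub hτ h.1 h.2.1 H.ab
  have e2 := wzeta_sub hτ h.1 h.2.2.1 H.am
  have e3 := wzeta_sub' hτ h.1 h.2.2.2 H.ap
  have e4 := wzeta_sub hτ h.2.1 h.2.2.1 H.bm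
  have e5 := wzeta_sub' hτ h.2.1 h.2.2.2 H.bp
  have e6 := wzeta_sub' hτ h.2.2.1 h.2.2.2 H.pp
  simp only [vv, uu, KK]
  linear_combination e2 + e3 + e4 + e5 - e1 - e6

lemma tendsto_z_zeta (hτ : 0 < τ.im) (s : ℂ) :
    Tendsto (fun z => (z - s) * wzeta τ (z - s)) (𝓝[≠] s) (𝓝 1) := by
  have h1 : ContinuousAt (rz τ) (s - s) := by
    rw [sub_self]; exact (hasDerivAt_rz hτ (zero_mem_UU hτ)).continuousAt
  have h2 : ContinuousAt (fun z => rz τ (z - s)) s :=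
    ContinuousAt.comp (f := fun x : ℂ => x - s) h1 (by fun_prop)
  have h3 : ContinuousAt (fun z => 1 + (z - s) * rz τ (z - s)) s := by fun_prop
  have h4 := h3.tendsto.mono_left (nhdsWithin_le_nhds (s := {s}ᶜ))
  simp only [sub_self, zero_mul, add_zero] at h4
  refine h4.congr' ?_
  filter_upwards [self_mem_nhdsWithin] with z hz
  have : z - s ≠ 0 := sub_ne_zero.mpr hz
  rw [wzeta_eq]
  field_simp

/-- zeta times vanishing factor at a regular point -/
lemma tendsto_reg (hτ : 0 < τ.im) {s t : ℂ} (h : s - t ∉ lat τ) :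
    Tendsto (fun z => (z - s) * wzeta τ (z - t)) (𝓝[≠] s) (𝓝 0) := by
  have h1 : ContinuousAt (wzeta τ) (s - t) := (hasDerivAt_wzeta hτ h).continuousAt
  have h2 : ContinuousAt (fun z => wzeta τ (z - t)) s :=
    ContinuousAt.comp (f := fun x : ℂ => x - t) h1 (by fun_prop)
  have h3 : ContinuousAt (fun z => (z - s) * wzeta τ (z - t)) s := by fun_prop
  have h4 := h3.tendsto.mono_left (nhdsWithin_le_nhds (s := {s}ᶜ))
  simpa using h4

lemma coef_zero (hτ : 0 < τ.im) {s t1 t2 t3 A B C D K : ℂ} (h1 : s - t1 ∉ lat τ)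
    (h2 : s - t2 ∉ lat τ) (h3 : s - t3 ∉ lat τ)
    (h : ∀ᶠ z in 𝓝[≠] s, A * wzeta τ (z - s) + B * wzeta τ (z - t1) + C * wzeta τ (z - t2)
      + D * wzeta τ (z - t3) + K = 0) : A = 0 := by
  have k0 := (tendsto_z_zeta hτ s).const_mul A
  have k1 := (tendsto_reg hτ h1).const_mul B
  have k2 := (tendsto_reg hτ h2).const_mul C
  have k3 := (tendsto_reg hτ h3).const_mul D
  have k4 : Tendsto (fun z => (z - s) * K) (𝓝[≠] s) (𝓝 0) := by
    have h3 : ContinuousAt (fun z => (z - s) * K) s := by fun_prop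
    simpa using h3.tendsto.mono_left (nhdsWithin_le_nhds (s := {s}ᶜ))
  have k := (((k0.add k1).add k2).add k3).add k4
  have e : A * 1 + B * 0 + C * 0 + D * 0 + 0 = A := by ring
  rw [e] at k
  have z0 : Tendsto (fun _ : ℂ => (0 : ℂ)) (𝓝[≠] s) (𝓝 A) := by
    refine k.congr' ?_
    filter_upwards [h] with z hz
    linear_combination (z - s) * hz
  exact tendsto_nhds_unique z0 tendsto_const_nhds

lemma lat_swap {x y : ℂ} (h : x - y ∉ lat τ) : y - x ∉ lat τ := by
  rw [← lat_neg_iff, neg_sub]; exact h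

lemma coefs (hτ : 0 < τ.im) {p a b A B C D K : ℂ} (H : Hyp τ p a b)
    (h : ∀ z, Good τ p a b z → A * wzeta τ (z - a) + B * wzeta τ (z - b) + C * wzeta τ (z - p)
      + D * wzeta τ (z + p) + K = 0) : A = 0 ∧ B = 0 ∧ C = 0 ∧ D = 0 ∧ K = 0 := by
  have hap : a - -p ∉ lat τ := by simpa using H.ap
  have hbp : b - -p ∉ lat τ := by simpa using H.bp
  have hpp : p - -p ∉ lat τ := by simpa using H.pp
  have hA : A = 0 := by
    refine coef_zero hτ (t1 := b) (t2 := p) (t3 := -p) (B := B) (C := C) (D := D) (K := K)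
      H.ab H.am hap ?_
    filter_upwards [Good_punct hτ p a b a] with z hz
    have := h z hz
    rw [sub_neg_eq_add]; linear_combination this
  have hB : B = 0 := by
    refine coef_zero hτ (t1 := a) (t2 := p) (t3 := -p) (B := A) (C := C) (D := D) (K := K)
      (lat_swap H.ab) H.bm hbp ?_
    filter_upwards [Good_punct hτ p a b b] with z hz
    have := h z hz
    rw [sub_neg_eq_add]; linear_combination this
  have hC : C = 0 := by
    refine coef_zero hτ (t1 := a) (t2 := b) (t3 := -p) (B := A) (C := B) (D := D) (K := K)
      (lat_swap H.am) (lat_swap H.bm) hpp ?_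
    filter_upwards [Good_punct hτ p a b p] with z hz
    have := h z hz
    rw [sub_neg_eq_add]; linear_combination this
  have hD : D = 0 := by
    refine coef_zero hτ (t1 := a) (t2 := b) (t3 := p) (B := A) (C := B) (D := C) (K := K)
      (lat_swap hap) (lat_swap hbp) (lat_swap hpp) ?_
    filter_upwards [Good_punct hτ p a b (-p)] with z hz
    have := h z hz
    rw [sub_neg_eq_add]; linear_combination this
  refine ⟨hA, hB, hC, hD, ?_⟩
  obtain ⟨z, hz⟩ := (Good_punct hτ p a b 0).exists
  simpa [hA, hB, hC, hD] using h z hz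

/-- The potential. -/
noncomputable def qq (τ p T E z : ℂ) : ℂ :=
  2 * (wp τ (z + p) + wp τ (z - p)) + T * (wzeta τ (z + p) - wzeta τ (z - p)) - E

lemma forward (hτ : 0 < τ.im) {p a b c T E : ℂ} (H : Hyp τ p a b)
    (h : ∀ z, Good τ p a b z → deriv (deriv (YY τ p a b c)) z = qq τ p T E z * YY τ p a b c z) :
    c + wzeta τ (a - b) - wzeta τ (a - p) - wzeta τ (a + p) = 0 ∧
    c - wzeta τ (a - b) - wzeta τ (b - p) - wzeta τ (b + p) = 0 ∧
    T = 2 * (c - wzeta τ (a - p) - wzeta τ (b - p) - wzeta τ (p + p)) ∧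
    T = -2 * (c - wzeta τ (a + p) - wzeta τ (b + p) + wzeta τ (p + p)) ∧
    E = - KK τ p a b c := by
  have := coefs hτ (A := 2 * (c + wzeta τ (a - b) - wzeta τ (a - p) - wzeta τ (a + p)))
    (B := 2 * (c - wzeta τ (a - b) - wzeta τ (b - p) - wzeta τ (b + p)))
    (C := T - 2 * (c - wzeta τ (a - p) - wzeta τ (b - p) - wzeta τ (p + p)))
    (D := - T - 2 * (c - wzeta τ (a + p) - wzeta τ (b + p) + wzeta τ (p + p)))
    (K := KK τ p a b c + E) H ?_
  · obtain ⟨h1, h2, h3, h4, h5⟩ := this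
    refine ⟨?_, ?_, ?_, ?_, ?_⟩
    · linear_combination h1 / 2
    · linear_combination h2 / 2
    · linear_combination h3
    · linear_combination -h4
    · linear_combination h5
  · intro z hz
    have e := h z hz
    rw [YY_deriv2 hτ hz] at e
    have e2 := mul_right_cancel₀ (YY_ne hτ hz) e
    rw [key hτ H hz, qq] at e2
    linear_combination e2

lemma YY_analytic (hτ : 0 < τ.im) {p a b c z : ℂ} (h1 : z - p ∉ lat τ) (h2 : z + p ∉ lat τ) :
    AnalyticAt ℂ (YY τ p a b c) z := by
  have hs : ∀ w, AnalyticAt ℂ (wsigma τ) w := fun w => (wsigma_diff hτ).analyticAt w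
  have d1 : Differentiable ℂ (fun z => Complex.exp (c * z) * wsigma τ (z - a) * wsigma τ (z - b)) := by
    have := wsigma_diff hτ
    fun_prop
  have d2 : Differentiable ℂ (fun z => wsigma τ (z - p) * wsigma τ (z + p)) := by
    have := wsigma_diff hτ
    fun_prop
  exact (d1.analyticAt z).div (d2.analyticAt z) (mul_ne_zero (wsigma_ne hτ h1) (wsigma_ne hτ h2))

lemma backward (hτ : 0 < τ.im) {p a b c T E : ℂ} (H : Hyp τ p a b)
    (h1 : c + wzeta τ (a - b) - wzeta τ (a - p) - wzeta τ (a + p) = 0)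
    (h2 : c - wzeta τ (a - b) - wzeta τ (b - p) - wzeta τ (b + p) = 0)
    (h3 : T = 2 * (c - wzeta τ (a - p) - wzeta τ (b - p) - wzeta τ (p + p)))
    (h4 : T = -2 * (c - wzeta τ (a + p) - wzeta τ (b + p) + wzeta τ (p + p)))
    (h5 : E = - KK τ p a b c) {z : ℂ} (hz1 : z - p ∉ lat τ) (hz2 : z + p ∉ lat τ) :
    deriv (deriv (YY τ p a b c)) z = qq τ p T E z * YY τ p a b c z := by
  have hg : ∀ᶠ w in 𝓝[≠] z, deriv (deriv (YY τ p a b c)) w = qq τ p T E w * YY τ p a b c w := by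
    filter_upwards [Good_punct hτ p a b z] with w hw
    rw [YY_deriv2 hτ hw, key hτ H hw, qq]
    linear_combination (2 * wzeta τ (w - a) * h1 + 2 * wzeta τ (w - b) * h2
      + wzeta τ (w - p) * h3 - wzeta τ (w + p) * h4 + h5) * YY τ p a b c w
  have hY := YY_analytic (a := a) (b := b) (c := c) hτ hz1 hz2
  have c1 : ContinuousAt (deriv (deriv (YY τ p a b c))) z := hY.deriv.deriv.continuousAt
  have z1 : ContinuousAt (fun w => wzeta τ (w - p)) z :=
    ((hasDerivAt_wzeta hτ hz1).comp_sub_const z p).continuousAt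
  have z2 : ContinuousAt (fun w => wzeta τ (w + p)) z :=
    ((hasDerivAt_wzeta hτ hz2).comp_add_const z p).continuousAt
  have p1 : ContinuousAt (fun w => wp τ (w - p)) z :=
    ((wp_diff hτ hz1).hasDerivAt.comp_sub_const z p).continuousAt
  have p2 : ContinuousAt (fun w => wp τ (w + p)) z :=
    ((wp_diff hτ hz2).hasDerivAt.comp_add_const z p).continuousAt
  have c2 : ContinuousAt (fun w => qq τ p T E w * YY τ p a b c w) z := by
    have := hY.continuousAt
    unfold qq
    fun_prop
  have t1 := c1.tendsto.mono_left (nhdsWithin_le_nhds (s := {z}ᶜ))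
  have t2 := c2.tendsto.mono_left (nhdsWithin_le_nhds (s := {z}ᶜ))
  exact tendsto_nhds_unique (t1.congr' hg) t2

end main


section final
variable {τ : ℂ}

lemma half_lat (hτ : 0 < τ.im) (m n : ℤ) (h : ¬ (Even m ∧ Even n)) :
    ((m : ℂ) + n * τ) / 2 ∉ lat τ := by
  rintro ⟨i, j, hij⟩
  have him := congrArg Complex.im hij
  have hre := congrArg Complex.re hij
  simp at him hre
  have hn : (n : ℝ) = 2 * j := by
    have : ((n : ℝ) - 2 * j) * τ.im = 0 := by linarith
    rcases mul_eq_zero.mp this with h | h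
    · linarith
    · exact absurd h hτ.ne'
  have hm : (m : ℝ) = 2 * i := by
    rw [hn] at hre; linarith
  apply h
  constructor
  · exact ⟨i, by have : m = 2 * i := by exact_mod_cast hm
                 omega⟩
  · exact ⟨j, by have : n = 2 * j := by exact_mod_cast hn
                 omega⟩

lemma half1 (hτ : 0 < τ.im) : (1 : ℂ) / 2 ∉ lat τ := by
  have := half_lat hτ 1 0 (by decide)
  simpa using this

lemma half2 (hτ : 0 < τ.im) : τ / 2 ∉ lat τ := by
  have := half_lat hτ 0 1 (by decide)
  simpa using this

lemma half3 (hτ : 0 < τ.im) : (1 + τ) / 2 ∉ lat τ := by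
  have := half_lat hτ 1 1 (by decide)
  simpa using this

lemma one_lat : (1 : ℂ) ∈ lat τ := ⟨1, 0, by simp⟩
lemma tau_lat : τ ∈ lat τ := ⟨0, 1, by simp⟩

lemma per_half (hτ : 0 < τ.im) {k : ℕ} (hk : k = 1 ∨ k = 2 ∨ k = 3) : per τ k / 2 ∉ lat τ := by
  rcases hk with rfl | rfl | rfl
  · exact half1 hτ
  · exact half2 hτ
  · exact half3 hτ

lemma etaq_eq (hτ : 0 < τ.im) {k : ℕ} (hk : k = 1 ∨ k = 2 ∨ k = 3) :
    etaq τ k = 2 * wzeta τ (per τ k / 2) := by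
  rcases hk with rfl | rfl | rfl
  · rfl
  · rfl
  · have h1 := wzeta_quasi_half hτ one_lat (half1 hτ)
    have h2 := wzeta_quasi_half hτ tau_lat (half2 hτ)
    have h3 := wzeta_quasi_half hτ (lat_add one_lat tau_lat) (half3 hτ)
    have e3 := h3 _ (half1 hτ)
    have e1 := h1 _ (half1 hτ)
    have hn : (1 : ℂ) / 2 + 1 ∉ lat τ := by rw [lat_add_iff one_lat]; exact half1 hτ
    have e2 := h2 _ hn
    rw [← add_assoc, e2, e1] at e3
    show eta1 τ + eta2 τ = 2 * wzeta τ ((1 + τ) / 2)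
    unfold eta1 eta2
    linear_combination e3

lemma qSing_iff (k : ℕ) (z : ℂ) :
    z ∉ qSing τ k ↔ z - per τ k / 4 ∉ lat τ ∧ z + per τ k / 4 ∉ lat τ := by
  rw [← not_or, not_iff_not]
  constructor
  · rintro ⟨l, hl, h | h⟩
    · left; rw [h]; simpa using hl
    · right; rw [h]; simpa using hl
  · rintro (h | h)
    · exact ⟨_, h, Or.inl (by ring)⟩
    · exact ⟨_, h, Or.inr (by ring)⟩

lemma E_formula (hτ : 0 < τ.im) {p a b c T : ℂ} (H : Hyp τ p a b)
    (h1 : c + wzeta τ (a - b) - wzeta τ (a - p) - wzeta τ (a + p) = 0)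
    (h2 : c - wzeta τ (a - b) - wzeta τ (b - p) - wzeta τ (b + p) = 0)
    (h3 : T = 2 * (c - wzeta τ (a - p) - wzeta τ (b - p) - wzeta τ (p + p))) :
    KK τ p a b c = T ^ 2 / 4 - wzeta τ (p + p) * T - 3 * wp τ (p + p)
      + (wp τ (a - p) + wp τ (b - p)) := by
  have r1 := wzeta_sub' hτ H.am H.ap H.pp
  have r2 := wzeta_sub' hτ H.bm H.bp H.pp
  have s := wzeta_sub hτ H.ab H.am H.bm
  have e1 : wzeta τ (a + p) = c + wzeta τ (a - b) - wzeta τ (a - p) := by linear_combination -h1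
  have e2 : wzeta τ (b + p) = c - wzeta τ (a - b) - wzeta τ (b - p) := by linear_combination -h2
  unfold KK
  rw [h3]
  rw [e1] at r1 ⊢
  rw [e2] at r2 ⊢
  linear_combination s - r1 - r2

end final

/-- **Theorem (Statement 16).** The sigma-function ansatz `y` solves `y″ = q_k(·;T,E)·y` for
some `c, T, E` iff the zeta relation between `a₁` and `a₂` holds; in that case `T, E, c` are
determined by the indicated formulas. -/
theorem statement16 (τ : ℂ) (hτ : 0 < τ.im) (k : ℕ) (hk : k = 1 ∨ k = 2 ∨ k = 3)
    (a₁ a₂ : ℂ) (h12 : a₁ - a₂ ∉ lat τ) (h1 : a₁ ∉ qSing τ k) (h2 : a₂ ∉ qSing τ k) :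
    ((∃ c T E : ℂ, ∀ z ∉ qSing τ k,
        deriv (deriv (sigY τ k a₁ a₂ c)) z = qPot k T E τ z * sigY τ k a₁ a₂ c z) ↔
      (1 / 2) * (wzeta τ (a₂ + per τ k / 4) + wzeta τ (a₂ - per τ k / 4)) =
        (1 / 2) * (wzeta τ (a₁ + per τ k / 4) + wzeta τ (a₁ - per τ k / 4))
          - wzeta τ (a₁ - a₂)) ∧
    (∀ c T E : ℂ,
      (∀ z ∉ qSing τ k,
        deriv (deriv (sigY τ k a₁ a₂ c)) z = qPot k T E τ z * sigY τ k a₁ a₂ c z) →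
      (-T = etaq τ k - ((wzeta τ (a₁ + per τ k / 4) - wzeta τ (a₁ - per τ k / 4)) +
          (wzeta τ (a₂ + per τ k / 4) - wzeta τ (a₂ - per τ k / 4))) ∧
       -E = T ^ 2 / 4 - etaq τ k / 2 * T - 3 * eper τ k +
          (wp τ (a₁ - per τ k / 4) + wp τ (a₂ - per τ k / 4)) ∧
       c = T / 2 + etaq τ k / 2 +
          (wzeta τ (a₁ - per τ k / 4) + wzeta τ (a₂ - per τ k / 4)))) := by

  have hp2 : per τ k / 4 + per τ k / 4 = per τ k / 2 := by ring
  have heta := etaq_eq hτ hk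
  have hpp := per_half hτ hk
  rw [qSing_iff] at h1 h2
  have H : Hyp τ (per τ k / 4) a₁ a₂ :=
    ⟨h12, by rw [hp2]; exact hpp, h1.1, h1.2, h2.1, h2.2⟩
  have fw : ∀ c T E : ℂ, (∀ z ∉ qSing τ k,
        deriv (deriv (sigY τ k a₁ a₂ c)) z = qPot k T E τ z * sigY τ k a₁ a₂ c z) → _ :=
    fun c T E h => forward (c := c) (T := T) (E := E) hτ H
      (fun z hz => h z ((qSing_iff k z).mpr hz.2.2))
  refine ⟨⟨?_, ?_⟩, ?_⟩
  · rintro ⟨c, T, E, h⟩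
    obtain ⟨f1, f2, -, -, -⟩ := fw c T E h
    linear_combination (f1 - f2) / 2
  · intro h
    obtain ⟨c, hc⟩ : ∃ c, c = wzeta τ (a₁ - per τ k / 4) + wzeta τ (a₁ + per τ k / 4)
      - wzeta τ (a₁ - a₂) := ⟨_, rfl⟩
    refine ⟨c, 2 * (c - wzeta τ (a₁ - per τ k / 4) - wzeta τ (a₂ - per τ k / 4)
      - wzeta τ (per τ k / 4 + per τ k / 4)), - KK τ (per τ k / 4) a₁ a₂ c, fun z hz => ?_⟩
    rw [qSing_iff] at hz
    refine backward hτ H ?_ ?_ rfl ?_ rfl hz.1 hz.2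
    · linear_combination hc
    · linear_combination hc - 2 * h
    · linear_combination 4 * hc - 4 * h
  · intro c T E h
    obtain ⟨f1, f2, f3, f4, f5⟩ := fw c T E h
    have hE := E_formula hτ H f1 f2 f3
    rw [hp2] at hE f3 f4
    rw [heta]
    refine ⟨?_, ?_, ?_⟩
    · linear_combination -(f3 + f4) / 2
    · rw [f5, neg_neg, hE, eper]; ring
    · linear_combination -f3 / 2
end

section
/- For every τ ∈ ℍ and every (r,s) ∈ ℂ² ∖ (1/2)ℤ² (wherever all terms are finite), the following three factorization identities hold: (i) Z^{(𝐦₁)}(r,s,τ) = 4·Z(r, s/2, 2τ)·Z(r, (s+1)/2, 2τ); (ii) Z^{(𝐦₂)}(r,s,τ) = Z(r/2, s, τ/2)·Z((r+1)/2, s, τ/2); (iii) Z^{(𝐦₃)}(r,s,τ) = Z((r−s)/2, s, (1+τ)/2)·Z((r−s+1)/2, s, (1+τ)/2). -/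
open Metric Set Filter Topology

/-! ### Helper lemmas -/

namespace S17

noncomputable def ztE (L : PeriodPair) (l₀ z : ℂ) : ℂ :=
  ∑' l : L.lattice, if (l : ℂ) = l₀ then 0 else (1 / (z - l) + 1 / (l : ℂ) + z / (l : ℂ) ^ 2)

noncomputable def zt (L : PeriodPair) (z : ℂ) : ℂ :=
  ∑' l : L.lattice, (1 / (z - l) + 1 / (l : ℂ) + z / (l : ℂ) ^ 2)

lemma zt_bound (r : ℝ) (hr : 0 < r) (s : ℂ) (hs : ‖s‖ < r) (l : ℂ) (h : 2 * r ≤ ‖l‖) :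
    ‖1 / (s - l) + 1 / l + s / l ^ 2‖ ≤ 2 * r ^ 2 * ‖l‖ ^ (-3 : ℝ) := by
  have h1 : s - l ≠ 0 := by
    intro h0
    have : s = l := sub_eq_zero.mp h0
    subst this; linarith
  have h2 : 0 < ‖l‖ := by linarith
  have h3 : l ≠ 0 := norm_pos_iff.mp h2
  have h4 : ‖l‖ / 2 ≤ ‖s - l‖ := by
    rw [norm_sub_rev]
    exact .trans (by linarith) (norm_sub_norm_le l s)
  have e : 1 / (s - l) + 1 / l + s / l ^ 2 = s ^ 2 / ((s - l) * l ^ 2) := by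
    field_simp
    ring
  rw [e]
  calc _ = ‖s‖ ^ 2 / (‖s - l‖ * ‖l‖ ^ 2) := by simp
    _ ≤ r ^ 2 / ((‖l‖ / 2) * ‖l‖ ^ 2) := by gcongr
    _ = 2 * r ^ 2 / ‖l‖ ^ 3 := by field_simp
    _ = _ := by norm_cast

lemma hsLU (L : PeriodPair) (l₀ : ℂ) :
    HasSumLocallyUniformly
      (fun (l : L.lattice) (z : ℂ) ↦ if (l : ℂ) = l₀ then 0 else
        (1 / (z - l) + 1 / (l : ℂ) + z / (l : ℂ) ^ 2))
      (ztE L l₀) := by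
  refine L.hasSumLocallyUniformly_aux (u := (2 * · ^ 2 * ‖·‖ ^ (-3 : ℝ))) _
    (fun _ _ ↦ (ZLattice.summable_norm_rpow _ _ (by simp; norm_num)).mul_left _) fun r hr ↦
    Filter.eventually_atTop.mpr ⟨2 * r, ?_⟩
  rintro _ h s hs l rfl
  split_ifs
  · simpa using! show 0 ≤ 2 * r ^ 2 * (‖(l : ℂ)‖ ^ 3)⁻¹ by positivity
  · exact zt_bound r hr s hs l h

lemma diffE (L : PeriodPair) (l₀ : ℂ) :
    DifferentiableOn ℂ (ztE L l₀) (L.lattice \ {l₀})ᶜ := by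
  refine (hsLU L l₀).hasSumLocallyUniformlyOn.differentiableOn
    (.of_forall fun s ↦ .fun_sum fun i hi ↦ ?_) L.isOpen_compl_lattice_sdiff
  split_ifs with hi
  · simp
  · refine .add (.add (.div (by fun_prop) (by fun_prop) ?_) (by fun_prop)) (by fun_prop)
    intro x hx h0
    apply hx
    rw [sub_eq_zero.mp h0]
    exact ⟨i.2, hi⟩

lemma ztE_notMem (L : PeriodPair) (l₀ : ℂ) (hl : l₀ ∉ L.lattice) : ztE L l₀ = zt L := by
  funext z
  unfold ztE zt
  refine tsum_congr fun l => if_neg ?_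
  rintro rfl
  exact hl l.2

lemma hasSum_zt (L : PeriodPair) (z : ℂ) :
    HasSum (fun l : L.lattice ↦ (1 / (z - l) + 1 / (l : ℂ) + z / (l : ℂ) ^ 2)) (zt L z) := by
  have h := (hsLU L (L.ω₁ / 2)).hasSum (x := z)
  rw [ztE_notMem _ _ L.ω₁_div_two_notMem_lattice] at h
  convert h using 2 with l
  rw [if_neg]; exact fun e ↦ L.ω₁_div_two_notMem_lattice (e ▸ l.2)

lemma diff_zt (L : PeriodPair) {z : ℂ} (hz : z ∉ L.lattice) : DifferentiableAt ℂ (zt L) z := by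
  have h := diffE L (L.ω₁ / 2)
  rw [ztE_notMem _ _ L.ω₁_div_two_notMem_lattice] at h
  refine (h z (fun h => hz h.1)).differentiableAt (L.isOpen_compl_lattice_sdiff.mem_nhds ?_)
  exact fun h => hz h.1

lemma diff_ztE (L : PeriodPair) : DifferentiableAt ℂ (ztE L 0) 0 :=
  (diffE L 0 0 (by simp)).differentiableAt (L.compl_lattice_sdiff_singleton_mem_nhds 0)

lemma zt_eq (L : PeriodPair) (z : ℂ) : zt L z = 1 / z + ztE L 0 z := by
  have h := (hasSum_zt L z).summable.tsum_eq_add_tsum_ite (0 : L.lattice)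
  rw [zt, h, ztE]
  congr 1
  · simp
  · refine tsum_congr fun l => ?_
    simp

lemma zt_zero (L : PeriodPair) : zt L 0 = 0 := by
  simp [zt]

lemma ztE_zero (L : PeriodPair) : ztE L 0 0 = 0 := by
  have := zt_eq L 0
  simpa [zt_zero] using this.symm

lemma zt_neg (L : PeriodPair) (z : ℂ) : zt L (-z) = - zt L z := by
  unfold zt
  rw [← (Equiv.neg L.lattice).tsum_eq, ← tsum_neg]
  refine tsum_congr fun l => ?_
  have : -z - -(l : ℂ) = -(z - l) := by ring
  simp only [Equiv.neg_apply, this, NegMemClass.coe_neg, div_eq_mul_inv, inv_neg, neg_sq]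
  ring

lemma zt_add (L : PeriodPair) (z : ℂ) {l₀ : ℂ} (hl : l₀ ∈ L.lattice) :
    zt L (z + l₀) = zt L z + zt L l₀ := by
  have key : ∀ z, HasSum (fun l : L.lattice ↦ 1 / ((l : ℂ) + l₀) - 1 / l
      + l₀ / ((l : ℂ) + l₀) ^ 2) (zt L (z + l₀) - zt L z) := by
    intro z
    have h1 := (Equiv.addRight (⟨l₀, hl⟩ : L.lattice)).hasSum_iff.mpr (hasSum_zt L (z + l₀))
    have h2 := hasSum_zt L z
    have h3 := (L.hasSum_weierstrassP (-l₀)).mul_left z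
    have h0 : L.weierstrassP (-l₀) = 0 := by
      rw [L.weierstrassP_neg]; exact L.weierstrassP_coe ⟨l₀, hl⟩
    rw [h0, mul_zero] at h3
    convert! (h1.sub h2).sub h3 using 1
    · funext l
      have e1 : z + l₀ - ((l : ℂ) + l₀) = z - l := by ring
      have e2 : (-l₀ - (l : ℂ)) ^ 2 = (l + l₀) ^ 2 := by ring
      simp [e1, e2, div_eq_mul_inv]
      ring
    · ring
  have := (key z).unique (key 0)
  simp only [zero_add, zt_zero] at this
  linear_combination this

lemma zt_half (L : PeriodPair) {u : ℂ} (hu : 2 * u ∈ L.lattice) : zt L (2 * u) = 2 * zt L u := by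
  have := zt_add L (-u) hu
  rw [zt_neg, show -u + 2 * u = u by ring] at this
  linear_combination -this

lemma split_aux (M L : PeriodPair) (w : ℂ) (hw : w ∉ M.lattice)
    (hL : ∀ x, x ∈ L.lattice ↔ x ∈ M.lattice ∨ x - w ∈ M.lattice) (f : ℂ → ℂ) (a b : ℂ)
    (ha : HasSum (fun l : M.lattice => f l) a) (hb : HasSum (fun l : M.lattice => f (l + w)) b) :
    HasSum (fun l : L.lattice => f l) (a + b) := by
  let e : M.lattice ⊕ M.lattice → L.lattice := Sum.elim
    (fun l => ⟨l, (hL _).2 (Or.inl l.2)⟩) (fun l => ⟨l + w, (hL _).2 (Or.inr (by simp))⟩)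
  have he : Function.Bijective e := by
    constructor
    · rintro (x | x) (y | y) h <;> simp [e] at h
      · simp [h]
      · exfalso; apply hw
        rw [show w = x - y by rw [h]; ring]
        exact sub_mem x.2 y.2
      · exfalso; apply hw
        rw [show w = y - x by rw [← h]; ring]
        exact sub_mem y.2 x.2
      · simp [h]
    · rintro ⟨x, hx⟩
      rcases (hL x).1 hx with h | h
      · exact ⟨Sum.inl ⟨x, h⟩, rfl⟩
      · exact ⟨Sum.inr ⟨x - w, h⟩, by simp [e]⟩
  rw [← (Equiv.ofBijective e he).hasSum_iff]
  exact HasSum.sum (f := _) ha hb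

lemma wp_split (M L : PeriodPair) (w : ℂ) (hw : w ∉ M.lattice)
    (hL : ∀ x, x ∈ L.lattice ↔ x ∈ M.lattice ∨ x - w ∈ M.lattice) (z : ℂ) :
    L.weierstrassP z = M.weierstrassP z + M.weierstrassP (z - w) - M.weierstrassP w := by
  have h2 := (M.hasSum_weierstrassP (z - w)).sub (M.hasSum_weierstrassP (-w))
  have h3 : HasSum (fun l : M.lattice => 1 / (z - ((l : ℂ) + w)) ^ 2 - 1 / ((l : ℂ) + w) ^ 2)
      (M.weierstrassP (z - w) - M.weierstrassP (-w)) := by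
    refine (congrArg (fun g => HasSum g _) (funext fun l => ?_)).mpr h2
    rw [show z - ((l : ℂ) + w) = z - w - l by ring, show (-w - (l : ℂ)) ^ 2 = (l + w) ^ 2 by ring]
    ring
  have := split_aux M L w hw hL (fun l => 1 / (z - l) ^ 2 - 1 / l ^ 2) (M.weierstrassP z)
    (M.weierstrassP (z - w) - M.weierstrassP (-w)) (M.hasSum_weierstrassP z) h3
  rw [(L.hasSum_weierstrassP z).unique this, M.weierstrassP_neg]
  ring

lemma zt_split (M L : PeriodPair) (w : ℂ) (hw : w ∉ M.lattice)
    (hL : ∀ x, x ∈ L.lattice ↔ x ∈ M.lattice ∨ x - w ∈ M.lattice) (z : ℂ) :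
    zt L z = zt M z + zt M (z - w) + zt M w + z * M.weierstrassP w := by
  have h2 := ((hasSum_zt M (z - w)).sub (hasSum_zt M (-w))).add
    ((M.hasSum_weierstrassP (-w)).mul_left z)
  have h3 : HasSum (fun l : M.lattice => 1 / (z - ((l : ℂ) + w)) + 1 / ((l : ℂ) + w)
      + z / ((l : ℂ) + w) ^ 2) (zt M (z - w) - zt M (-w) + z * M.weierstrassP (-w)) := by
    refine (congrArg (fun g => HasSum g _) (funext fun l => ?_)).mpr h2
    rw [show z - ((l : ℂ) + w) = z - w - l by ring, show (-w - (l : ℂ)) = -(l + w) by ring]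
    simp only [div_eq_mul_inv, inv_neg, neg_sq]
    ring
  have := split_aux M L w hw hL (fun l => 1 / (z - l) + 1 / l + z / l ^ 2) (zt M z)
    (zt M (z - w) - zt M (-w) + z * M.weierstrassP (-w)) (hasSum_zt M z) h3
  rw [(hasSum_zt L z).unique this, M.weierstrassP_neg, zt_neg]
  ring

noncomputable def GG (M : PeriodPair) (w z : ℂ) : ℂ := zt M z - zt M (z + w) + zt M w

open Classical in
noncomputable def HH (M L : PeriodPair) (w c z : ℂ) : ℂ :=
  if z ∈ L.lattice then c else GG M w z ^ 2 - L.weierstrassP z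

lemma GG_add (M : PeriodPair) (w z l : ℂ) (hl : l ∈ M.lattice) : GG M w (z + l) = GG M w z := by
  unfold GG
  rw [zt_add M z hl, show z + l + w = z + w + l by ring, zt_add M _ hl]
  ring

lemma GG_w (M : PeriodPair) (w z : ℂ) (hw : 2 * w ∈ M.lattice) :
    GG M w (z + w) = - GG M w z := by
  unfold GG
  rw [show z + w + w = z + 2 * w by ring, zt_add M _ hw, zt_half M hw]
  ring

lemma GG_sq (M L : PeriodPair) (w : ℂ) (hw2 : 2 * w ∈ M.lattice)
    (hL : ∀ x, x ∈ L.lattice ↔ x ∈ M.lattice ∨ x - w ∈ M.lattice) (z l : ℂ) (hl : l ∈ L.lattice) :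
    GG M w (z + l) ^ 2 = GG M w z ^ 2 := by
  rcases (hL l).1 hl with h | h
  · rw [GG_add _ _ _ _ h]
  · rw [show z + l = z + w + (l - w) by ring, GG_add _ _ _ _ h, GG_w _ _ _ hw2]
    ring

lemma HH_add (M L : PeriodPair) (w c : ℂ) (hw2 : 2 * w ∈ M.lattice)
    (hL : ∀ x, x ∈ L.lattice ↔ x ∈ M.lattice ∨ x - w ∈ M.lattice) (z l : ℂ) (hl : l ∈ L.lattice) :
    HH M L w c (z + l) = HH M L w c z := by
  unfold HH
  have h1 : z + l ∈ L.lattice ↔ z ∈ L.lattice :=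
    L.lattice.toAddSubgroup.add_mem_cancel_right (y := z) hl
  have h2 := L.weierstrassP_add_coe z ⟨l, hl⟩
  simp only at h2
  rw [GG_sq M L w hw2 hL z l hl, h2]
  by_cases hz : z ∈ L.lattice
  · rw [if_pos hz, if_pos (h1.2 hz)]
  · rw [if_neg hz, if_neg (fun h => hz (h1.1 h))]

lemma HH_exists (M L : PeriodPair) (w : ℂ) (hw : w ∉ M.lattice) (hw2 : 2 * w ∈ M.lattice)
    (hL : ∀ x, x ∈ L.lattice ↔ x ∈ M.lattice ∨ x - w ∈ M.lattice) :
    ∃ c, Differentiable ℂ (HH M L w c) := by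
  let h : ℂ → ℂ := fun z => ztE M 0 z - zt M (z + w) + zt M w
  have ML : ∀ x, x ∈ M.lattice → x ∈ L.lattice := fun x hx => (hL x).2 (Or.inl hx)
  have wL : w ∈ L.lattice := (hL w).2 (Or.inr (by simp))
  -- h is analytic at zero
  have hh : AnalyticAt ℂ h 0 := by
    apply DifferentiableOn.analyticAt (s := (↑M.lattice \ {0})ᶜ ∩ (fun z => z + w) ⁻¹' (M.lattice : Set ℂ)ᶜ)
    · intro x hx
      refine DifferentiableAt.differentiableWithinAt ?_
      refine ((((diffE M 0) x hx.1).differentiableAt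
        (M.isOpen_compl_lattice_sdiff.mem_nhds hx.1)).sub ?_).add_const _
      exact differentiableAt_comp_add_const.2 (diff_zt M hx.2)
    · refine inter_mem (M.compl_lattice_sdiff_singleton_mem_nhds 0) ?_
      exact (M.isClosed_lattice.isOpen_compl.preimage (by fun_prop)).mem_nhds (by simpa using hw)
  have h0 : h 0 = 0 := by simp [h, ztE_zero]
  refine ⟨2 * deriv h 0, fun z => ?_⟩
  have d0 : DifferentiableAt ℂ (HH M L w (2 * deriv h 0)) 0 := by
    have hd : DifferentiableAt ℂ (dslope h 0) 0 := by
      obtain ⟨p, hp⟩ := hh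
      exact (hp.has_fpower_series_dslope_fslope).analyticAt.differentiableAt
    have hP : DifferentiableAt ℂ (L.weierstrassPExcept 0) 0 :=
      (L.analyticAt_weierstrassPExcept 0).differentiableAt
    have : DifferentiableAt ℂ (fun z => 2 * dslope h 0 z + h z ^ 2 - L.weierstrassPExcept 0 z) 0 :=
      ((hd.const_mul 2).add (hh.differentiableAt.pow 2)).sub hP
    refine this.congr_of_eventuallyEq ?_
    filter_upwards [L.compl_lattice_sdiff_singleton_mem_nhds 0] with x hx
    by_cases hx0 : x = 0
    · subst hx0
      simp [HH, h0]
    · have hxL : x ∉ L.lattice := fun h' => hx ⟨h', hx0⟩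
      have e1 : L.weierstrassPExcept 0 x = L.weierstrassP x - 1 / x ^ 2 := by
        have := L.weierstrassPExcept_def 0 x
        simp at this
        rw [this]; simp [sub_eq_add_neg]
      have e2 : GG M w x = 1 / x + h x := by
        simp only [GG, h]
        rw [zt_eq M x]; ring
      rw [HH, if_neg hxL, e1, e2, dslope_of_ne _ hx0, slope_def_field, h0]
      field_simp
      ring
  by_cases hz : z ∈ L.lattice
  · have e : HH M L w (2 * deriv h 0) = fun x => HH M L w (2 * deriv h 0) (x - z) := by
      funext x
      conv_lhs => rw [← sub_add_cancel x z]
      exact HH_add M L w _ hw2 hL _ _ hz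
    rw [e]
    refine differentiableAt_comp_sub_const.2 ?_
    simpa using d0
  · have hzw : z + w ∉ M.lattice := fun h' => hz (by
      have := sub_mem (ML _ h') wL
      simpa using this)
    have : DifferentiableAt ℂ (fun x => GG M w x ^ 2 - L.weierstrassP x) z := by
      refine DifferentiableAt.sub (DifferentiableAt.pow ?_ 2)
        (L.analyticOnNhd_weierstrassP z hz).differentiableAt
      exact ((diff_zt M (fun h' => hz (ML _ h'))).sub
        (differentiableAt_comp_add_const.2 (diff_zt M hzw))).add_const _
    refine this.congr_of_eventuallyEq ?_
    filter_upwards [L.isClosed_lattice.isOpen_compl.mem_nhds hz] with x hx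
    exact if_neg hx

lemma zt_half_add (M : PeriodPair) {u v : ℂ} (hu : 2 * u ∈ M.lattice) (hv : 2 * v ∈ M.lattice) :
    zt M (u + v) = zt M u + zt M v := by
  have h := zt_half M (u := u + v) (by rw [mul_add]; exact add_mem hu hv)
  rw [mul_add, zt_add M _ hv, zt_half M hu, zt_half M hv] at h
  linear_combination -h / 2

lemma GG_formula (M L : PeriodPair) (w v : ℂ) (hw : w ∉ M.lattice) (hw2 : 2 * w ∈ M.lattice)
    (hL : ∀ x, x ∈ L.lattice ↔ x ∈ M.lattice ∨ x - w ∈ M.lattice)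
    (hv : v ∉ L.lattice) (hv2 : 2 * v ∈ M.lattice) (z : ℂ) (hz : z ∉ L.lattice) :
    GG M w z ^ 2 = L.weierstrassP z - L.weierstrassP v := by
  obtain ⟨c, hc⟩ := HH_exists M L w hw hw2 hL
  have := hc.apply_eq_apply_of_bounded (IsZLattice.isCompact_range_of_periodic L.lattice _
    hc.continuous fun z l hl ↦ HH_add M L w c hw2 hL z l hl).isBounded z v
  rw [HH, if_neg hz, HH, if_neg hv] at this
  have h0 : GG M w v = 0 := by
    rw [GG, zt_half_add M hv2 hw2]; ring
  rw [h0] at this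
  linear_combination this

theorem main (M L : PeriodPair) (w v : ℂ) (hw : w ∉ M.lattice) (hw2 : 2 * w ∈ M.lattice)
    (hL : ∀ x, x ∈ L.lattice ↔ x ∈ M.lattice ∨ x - w ∈ M.lattice)
    (hv : v ∉ L.lattice) (hv2 : 2 * v ∈ M.lattice) (a b z : ℂ) (hz : z ∉ L.lattice)
    (hzab : z = 2 * a * w + 2 * b * v) :
    (zt L z - 4 * a * zt L (w / 2) - 2 * b * zt L v) ^ 2 - L.weierstrassP z + L.weierstrassP v
      = 4 * (zt M z - 2 * a * zt M w - 2 * b * zt M v) *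
        (zt M (z + w) - (2 * a + 1) * zt M w - 2 * b * zt M v) := by
  have hG := GG_formula M L w v hw hw2 hL hv hv2 z hz
  have e1 : zt L (w / 2) = zt M w + w / 2 * M.weierstrassP w := by
    rw [zt_split M L w hw hL, show w / 2 - w = -(w / 2) by ring, zt_neg]
    ring
  have e0 : ∀ x, zt M (x - w) = zt M (x + w) - 2 * zt M w := by
    intro x
    have := zt_add M (x - w) hw2
    rw [zt_half M hw2, show x - w + 2 * w = x + w by ring] at this
    linear_combination -this
  have e2 : zt L v = 2 * zt M v + v * M.weierstrassP w := by
    rw [zt_split M L w hw hL, e0, zt_half_add M hv2 hw2]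
    ring
  have e3 : zt L z - 4 * a * zt L (w / 2) - 2 * b * zt L v =
      (zt M z - 2 * a * zt M w - 2 * b * zt M v) +
        (zt M (z + w) - (2 * a + 1) * zt M w - 2 * b * zt M v) := by
    rw [e1, e2, zt_split M L w hw hL z, e0, ]
    linear_combination M.weierstrassP w * hzab
  rw [e3]
  unfold GG at hG
  linear_combination hG

/-- period pair from a determinant condition -/
noncomputable def mk (a b : ℂ) (h : a.re * b.im - a.im * b.re ≠ 0) : PeriodPair where
  ω₁ := a
  ω₂ := b
  indep := by
    rw [LinearIndependent.pair_iff]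
    intro s t hst
    have h1 := congrArg Complex.re hst
    have h2 := congrArg Complex.im hst
    simp at h1 h2
    constructor
    · have : s * (a.re * b.im - a.im * b.re) = 0 := by linear_combination b.im * h1 - b.re * h2
      exact (mul_eq_zero.mp this).resolve_right h
    · have : t * (a.re * b.im - a.im * b.re) = 0 := by linear_combination a.re * h2 - a.im * h1
      exact (mul_eq_zero.mp this).resolve_right h

theorem main' (w v : ℂ) (h : w.re * v.im - w.im * v.re ≠ 0) (a b z : ℂ)
    (M L : PeriodPair) (hM1 : M.ω₁ = 2 * w) (hM2 : M.ω₂ = 2 * v) (hL1 : L.ω₁ = w)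
    (hL2 : L.ω₂ = 2 * v) (hz : z ∉ L.lattice)
    (hzab : z = 2 * a * w + 2 * b * v) :
    (zt L z - 4 * a * zt L (w / 2) - 2 * b * zt L v) ^ 2 - L.weierstrassP z + L.weierstrassP v
      = 4 * (zt M z - 2 * a * zt M w - 2 * b * zt M v) *
        (zt M (z + w) - (2 * a + 1) * zt M w - 2 * b * zt M v) := by
  refine main M L w v ?_ ?_ ?_ ?_ ?_ a b z hz hzab
  · have := M.ω₁_div_two_notMem_lattice
    rwa [hM1, mul_div_cancel_left₀ _ two_ne_zero] at this
  · rw [← hM1]; exact M.ω₁_mem_lattice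
  · intro x
    simp only [PeriodPair.mem_lattice, hM1, hM2, hL1, hL2]
    constructor
    · rintro ⟨m, n, rfl⟩
      rcases Int.even_or_odd' m with ⟨k, rfl | rfl⟩
      · exact Or.inl ⟨k, n, by push_cast; ring⟩
      · exact Or.inr ⟨k, n, by push_cast; ring⟩
    · rintro (⟨m, n, hx⟩ | ⟨m, n, hx⟩)
      · exact ⟨2 * m, n, by push_cast; linear_combination hx⟩
      · exact ⟨2 * m + 1, n, by push_cast; linear_combination hx⟩
  · have := L.ω₂_div_two_notMem_lattice
    rwa [hL2, mul_div_cancel_left₀ _ two_ne_zero] at this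
  · rw [← hM2]; exact M.ω₂_mem_lattice

lemma latPt_bij (L : PeriodPair) (c τ : ℂ) (hc : c ≠ 0) (hτ : τ.im ≠ 0)
    (hL : ∀ x, x ∈ L.lattice ↔ ∃ m n : ℤ, x = c * (m + n * τ)) :
    ∃ e : ℤ × ℤ ≃ L.lattice, ∀ p, (e p : ℂ) = c * latPt τ p := by
  refine ⟨Equiv.ofBijective (fun p => ⟨c * latPt τ p, (hL _).2 ⟨p.1, p.2, rfl⟩⟩) ⟨?_, ?_⟩,
    fun p => rfl⟩
  · rintro ⟨m, n⟩ ⟨m', n'⟩ h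
    simp only [Subtype.mk.injEq, latPt] at h
    have h := mul_left_cancel₀ hc h
    have h1 := congrArg Complex.im h
    simp [hτ] at h1
    subst h1
    simpa using h
  · rintro ⟨x, hx⟩
    obtain ⟨m, n, rfl⟩ := (hL x).1 hx
    exact ⟨(m, n), rfl⟩

lemma tsum_ne_zero (f : ℤ × ℤ → ℂ) (hf : Summable f) :
    f 0 + ∑' p : {p : ℤ × ℤ // p ≠ 0}, f p = ∑' p, f p := by
  rw [hf.tsum_eq_add_tsum_ite 0]
  congr 1
  have := tsum_subtype {p : ℤ × ℤ | p ≠ 0} f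
  refine this.trans (tsum_congr fun p => ?_)
  by_cases hp : p = 0 <;> simp [Set.indicator, hp]

lemma wzeta_eq (L : PeriodPair) (c τ : ℂ) (hc : c ≠ 0) (hτ : τ.im ≠ 0)
    (hL : ∀ x, x ∈ L.lattice ↔ ∃ m n : ℤ, x = c * (m + n * τ)) (z : ℂ) :
    wzeta τ z = c * zt L (c * z) := by
  obtain ⟨e, he⟩ := latPt_bij L c τ hc hτ hL
  have h := (e.hasSum_iff.mpr (hasSum_zt L (c * z))).mul_left c
  have h' : HasSum (fun p => 1 / (z - latPt τ p) + 1 / latPt τ p + z / latPt τ p ^ 2)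
      (c * zt L (c * z)) := by
    convert! h using 1
    funext p
    simp only [Function.comp, he, ← mul_sub, mul_pow]
    simp only [div_eq_mul_inv, mul_inv]
    field_simp
  rw [← h'.tsum_eq, ← tsum_ne_zero _ h'.summable]
  simp [wzeta, latPt]

lemma wp_eq (L : PeriodPair) (τ : ℂ) (hτ : τ.im ≠ 0)
    (hL : ∀ x, x ∈ L.lattice ↔ ∃ m n : ℤ, x = 1 * (m + n * τ)) (z : ℂ) :
    wp τ z = L.weierstrassP z := by
  obtain ⟨e, he⟩ := latPt_bij L 1 τ one_ne_zero hτ hL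
  have h := (e.hasSum_iff.mpr (L.hasSum_weierstrassP z))
  have h' : HasSum (fun p => 1 / (z - latPt τ p) ^ 2 - 1 / latPt τ p ^ 2)
      (L.weierstrassP z) := by
    convert! h using 1
    funext p
    simp only [Function.comp, he, one_mul]
  rw [← h'.tsum_eq, ← tsum_ne_zero _ h'.summable]
  simp [wp, latPt]

end S17

/-- **Theorem (Statement 17).** The factorization identities for `Z^{(𝐦_k)}`, `k = 1,2,3`,
wherever all terms are finite. -/
theorem statement17 (τ : ℂ) (hτ : 0 < τ.im) (r s : ℂ) (hrs : ¬ IsHalfIntPair r s)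
    (hfin : r + s * τ ∉ lat τ) :
    heckeZm 1 r s τ = 4 * heckeZ r (s / 2) (2 * τ) * heckeZ r ((s + 1) / 2) (2 * τ) ∧
    heckeZm 2 r s τ = heckeZ (r / 2) s (τ / 2) * heckeZ ((r + 1) / 2) s (τ / 2) ∧
    heckeZm 3 r s τ =
      heckeZ ((r - s) / 2) s ((1 + τ) / 2) * heckeZ ((r - s + 1) / 2) s ((1 + τ) / 2) := by
  have h2 : (2 : ℂ) ≠ 0 := two_ne_zero
  have hτ0 : τ.im ≠ 0 := hτ.ne'
  have hfin' : ∀ m n : ℤ, r + s * τ ≠ m + n * τ := fun m n h => hfin ⟨m, n, h⟩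
  refine ⟨?_, ?_, ?_⟩
  · let M := S17.mk (2 * τ) 1 (by simp [hτ0])
    let L := S17.mk τ 1 (by simp [hτ0])
    have hM : ∀ x, x ∈ M.lattice ↔ ∃ m n : ℤ, x = 1 * (m + n * (2 * τ)) := by
      intro x
      simp only [PeriodPair.mem_lattice, M, S17.mk]
      exact ⟨fun ⟨m, n, h⟩ => ⟨n, m, by rw [← h]; ring⟩, fun ⟨m, n, h⟩ => ⟨n, m, by rw [h]; ring⟩⟩
    have hL : ∀ x, x ∈ L.lattice ↔ ∃ m n : ℤ, x = 1 * (m + n * τ) := by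
      intro x
      simp only [PeriodPair.mem_lattice, L, S17.mk]
      exact ⟨fun ⟨m, n, h⟩ => ⟨n, m, by rw [← h]; ring⟩, fun ⟨m, n, h⟩ => ⟨n, m, by rw [h]; ring⟩⟩
    have key := S17.main' τ (1 / 2) (by simp [hτ0]) (s / 2) r (r + s * τ) M L rfl
      (by simp [M, S17.mk]) rfl (by simp [L, S17.mk])
      (fun h => by
        obtain ⟨m, n, h⟩ := (hL _).1 h
        exact hfin' m n (by rw [h]; ring)) (by ring)
    simp only [heckeZm, heckeZ, eper, per, eta1, eta2,
      S17.wzeta_eq M 1 (2 * τ) one_ne_zero (by simp [hτ0]) hM,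
      S17.wzeta_eq L 1 τ one_ne_zero hτ0 hL, S17.wp_eq L τ hτ0 hL, one_mul]
    rw [show r + s / 2 * (2 * τ) = r + s * τ by ring,
      show r + (s + 1) / 2 * (2 * τ) = r + s * τ + τ by ring, show 2 * τ / 2 = τ by ring]
    linear_combination key
  · let M := S17.mk 2 τ (by simp [hτ0])
    let L := S17.mk 1 τ (by simp [hτ0])
    have hM : ∀ x, x ∈ M.lattice ↔ ∃ m n : ℤ, x = 2 * (m + n * (τ / 2)) := by
      intro x
      simp only [PeriodPair.mem_lattice, M, S17.mk]
      exact ⟨fun ⟨m, n, h⟩ => ⟨m, n, by rw [← h]; ring⟩, fun ⟨m, n, h⟩ => ⟨m, n, by rw [h]; ring⟩⟩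
    have hL : ∀ x, x ∈ L.lattice ↔ ∃ m n : ℤ, x = 1 * (m + n * τ) := by
      intro x
      simp only [PeriodPair.mem_lattice, L, S17.mk]
      exact ⟨fun ⟨m, n, h⟩ => ⟨m, n, by rw [← h]; ring⟩, fun ⟨m, n, h⟩ => ⟨m, n, by rw [h]; ring⟩⟩
    have key := S17.main' 1 (τ / 2) (by simp [hτ0]) (r / 2) s (r + s * τ) M L
      (by simp [M, S17.mk]) (by simp only [M, S17.mk]; ring) rfl (by simp only [L, S17.mk]; ring)
      (fun h => by
        obtain ⟨m, n, h⟩ := (hL _).1 h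
        exact hfin' m n (by rw [h]; ring)) (by ring)
    simp only [heckeZm, heckeZ, eper, per, eta1, eta2,
      S17.wzeta_eq M 2 (τ / 2) two_ne_zero (by simp [hτ0]) hM,
      S17.wzeta_eq L 1 τ one_ne_zero hτ0 hL, S17.wp_eq L τ hτ0 hL, one_mul]
    rw [show 2 * (r / 2 + s * (τ / 2)) = r + s * τ by ring,
      show 2 * ((r + 1) / 2 + s * (τ / 2)) = r + s * τ + 1 by ring,
      show 2 * (τ / 2 / 2) = τ / 2 by ring, show (2 * (1 / 2) : ℂ) = 1 by norm_num]
    linear_combination key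
  · let M := S17.mk 2 (1 + τ) (by simp [hτ0])
    let L := S17.mk 1 (1 + τ) (by simp [hτ0])
    have hM : ∀ x, x ∈ M.lattice ↔ ∃ m n : ℤ, x = 2 * (m + n * ((1 + τ) / 2)) := by
      intro x
      simp only [PeriodPair.mem_lattice, M, S17.mk]
      exact ⟨fun ⟨m, n, h⟩ => ⟨m, n, by rw [← h]; ring⟩, fun ⟨m, n, h⟩ => ⟨m, n, by rw [h]; ring⟩⟩
    have hL : ∀ x, x ∈ L.lattice ↔ ∃ m n : ℤ, x = 1 * (m + n * τ) := by
      intro x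
      simp only [PeriodPair.mem_lattice, L, S17.mk]
      exact ⟨fun ⟨m, n, h⟩ => ⟨m + n, n, by rw [← h]; push_cast; ring⟩,
        fun ⟨m, n, h⟩ => ⟨m - n, n, by rw [h]; push_cast; ring⟩⟩
    have key := S17.main' 1 ((1 + τ) / 2) (by simp [hτ0]) ((r - s) / 2) s (r + s * τ) M L
      (by simp [M, S17.mk]) (by simp only [M, S17.mk]; ring) rfl (by simp only [L, S17.mk]; ring)
      (fun h => by
        obtain ⟨m, n, h⟩ := (hL _).1 h
        exact hfin' m n (by rw [h]; ring)) (by ring)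
    have e3 : S17.zt L ((1 + τ) / 2) = S17.zt L (1 / 2) + S17.zt L (τ / 2) := by
      rw [add_div]
      exact S17.zt_half_add L ((hL _).2 ⟨1, 0, by simp⟩) ((hL _).2 ⟨0, 1, by simp; ring⟩)
    simp only [heckeZm, heckeZ, eper, per, eta1, eta2,
      S17.wzeta_eq M 2 ((1 + τ) / 2) two_ne_zero (by simp [hτ0]) hM,
      S17.wzeta_eq L 1 τ one_ne_zero hτ0 hL, S17.wp_eq L τ hτ0 hL, one_mul]
    rw [e3] at key
    rw [show 2 * ((r - s) / 2 + s * ((1 + τ) / 2)) = r + s * τ by ring,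
      show 2 * ((r - s + 1) / 2 + s * ((1 + τ) / 2)) = r + s * τ + 1 by ring,
      show 2 * ((1 + τ) / 2 / 2) = (1 + τ) / 2 by ring, show (2 * (1 / 2) : ℂ) = 1 by norm_num]
    linear_combination key
end

section
/- Let (r,s) ∈ ℂ² ∖ (1/2)ℤ². Then: (i) the identity Z(r, s + 1/2, τ) = Z(r,s,τ) + ℘′(r + sτ|τ)/(2(℘(r + sτ|τ) − e₂(τ))) holds, and consequently there is no τ ∈ ℍ with Z(r,s,τ) = 0 = Z(r, s + 1/2, τ); (ii) the identity Z(r + 1/2, s, τ) = Z(r,s,τ) + ℘′(r + sτ|τ)/(2(℘(r + sτ|τ) − e₁(τ))) holds, and consequently there is no τ ∈ ℍ with Z(r,s,τ) = 0 = Z(r + 1/2, s, τ). -/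
open Metric Set Filter Topology

/-- `g` agrees near `z` (punctured) with a function analytic at `z`. -/
def Gd (g : ℂ → ℂ) (z : ℂ) : Prop := ∃ G : ℂ → ℂ, AnalyticAt ℂ G z ∧ g =ᶠ[𝓝[≠] z] G

lemma gd_unique {g G₁ G₂ : ℂ → ℂ} {z : ℂ} (h₁ : AnalyticAt ℂ G₁ z) (e₁ : g =ᶠ[𝓝[≠] z] G₁)
    (h₂ : AnalyticAt ℂ G₂ z) (e₂ : g =ᶠ[𝓝[≠] z] G₂) : G₁ z = G₂ z := by
  have h : G₁ =ᶠ[𝓝[≠] z] G₂ := e₁.symm.trans e₂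
  exact tendsto_nhds_unique_of_eventuallyEq
    (h₁.continuousAt.tendsto.mono_left nhdsWithin_le_nhds)
    (h₂.continuousAt.tendsto.mono_left nhdsWithin_le_nhds) h

lemma gd_of_analytic {g : ℂ → ℂ} {z : ℂ} (h : AnalyticAt ℂ g z) : Gd g z :=
  ⟨g, h, EventuallyEq.rfl⟩

lemma tendsto_shift (z a : ℂ) : Tendsto (fun x => x + a) (𝓝[≠] z) (𝓝[≠] (z + a)) := by
  refine tendsto_nhdsWithin_iff.2 ⟨?_, ?_⟩
  · exact ((continuous_id.add continuous_const).tendsto z).mono_left nhdsWithin_le_nhds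
  · filter_upwards [self_mem_nhdsWithin] with x hx
    simpa using hx

lemma gd_shift {g : ℂ → ℂ} {z a κ : ℂ} (h : Gd g z)
    (he : ∀ᶠ x in 𝓝[≠] z, g (x + a) = κ * g x) : Gd g (z + a) := by
  obtain ⟨G, hG, e⟩ := h
  refine ⟨fun x => κ * G (x - a), ?_, ?_⟩
  · have : AnalyticAt ℂ (fun x => G (x - a)) (z + a) :=
      AnalyticAt.fun_comp (f := fun x => x - a) (by simpa using hG) (by fun_prop)
    exact analyticAt_const.mul this
  · have := tendsto_shift (z + a) (-a)
    rw [add_neg_cancel_right] at this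
    filter_upwards [this.eventually e, this.eventually he] with x h1 h2
    simp only [neg_add_cancel_right] at h2
    rw [h2, h1, sub_eq_add_neg]

lemma ev_not_mem (L : PeriodPair) (z : ℂ) : ∀ᶠ x in 𝓝[≠] z, x ∉ L.lattice := by
  filter_upwards [self_mem_nhdsWithin, mem_nhdsWithin_of_mem_nhds
    (L.compl_lattice_sdiff_singleton_mem_nhds z)] with w hw hw'
  intro h
  exact hw' ⟨h, hw⟩

lemma ev_not_mem2 (L : PeriodPair) (z : ℂ) : ∀ᶠ x in 𝓝[≠] z, 2 * x ∉ L.lattice := by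
  have : Tendsto (fun x : ℂ => 2 * x) (𝓝[≠] z) (𝓝[≠] (2 * z)) := by
    refine tendsto_nhdsWithin_iff.2 ⟨?_, ?_⟩
    · exact ((continuous_const.mul continuous_id).tendsto z).mono_left nhdsWithin_le_nhds
    · filter_upwards [self_mem_nhdsWithin] with x hx
      simpa using hx
  exact this.eventually (ev_not_mem L _)

lemma not_mem_of_two {L : PeriodPair} {z : ℂ} (h : 2 * z ∉ L.lattice) : z ∉ L.lattice :=
  fun hz => h (by rw [two_mul]; exact add_mem hz hz)

lemma liouville (L : PeriodPair) (g : ℂ → ℂ) (w : ℂ)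
    (hper : ∀ l ∈ L.lattice, ∀ z, 2 * z ∉ L.lattice → g (z + l) = g z)
    (h0 : Gd g 0) (hw : Gd g w)
    (han : ∀ z, z ∉ L.lattice → z - w ∉ L.lattice → AnalyticAt ℂ g z) :
    ∃ c, ∀ z G, AnalyticAt ℂ G z → g =ᶠ[𝓝[≠] z] G → G z = c := by
  have hp (l) (hl : l ∈ L.lattice) (z : ℂ) : ∀ᶠ x in 𝓝[≠] z, g (x + l) = 1 * g x := by
    filter_upwards [ev_not_mem2 L z] with x hx
    rw [one_mul, hper l hl x hx]
  have hgd : ∀ z, Gd g z := by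
    intro z
    by_cases h1 : z ∈ L.lattice
    · simpa using gd_shift h0 (hp z h1 0)
    by_cases h2 : z - w ∈ L.lattice
    · simpa using gd_shift hw (hp _ h2 w)
    exact gd_of_analytic (han z h1 h2)
  choose G hG he using hgd
  let F : ℂ → ℂ := fun z => G z z
  have hF : ∀ z, F =ᶠ[𝓝 z] G z := by
    intro z
    have h1 : ∀ᶠ x in 𝓝[≠] z, F x = G z x := by
      filter_upwards [eventually_eventually_nhdsWithin.2 (he z), self_mem_nhdsWithin,
        mem_nhdsWithin_of_mem_nhds (hG z).eventually_analyticAt] with x hx hxz hxa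
      refine gd_unique (G₁ := G x) (hG x) (he x) hxa ?_
      have : 𝓝[≠] x ≤ 𝓝[≠] z ⊔ 𝓝[≠] x := le_sup_right
      have h3 : ∀ᶠ y in 𝓝 x, g y = G z y := by
        have : 𝓝[≠] z ≤ 𝓝 z := nhdsWithin_le_nhds
        rw [(isOpen_compl_singleton).nhdsWithin_eq hxz] at hx
        exact hx
      exact h3.filter_mono nhdsWithin_le_nhds
    rw [eventually_nhdsWithin_iff] at h1
    filter_upwards [h1] with x hx
    by_cases hxz : x = z
    · subst hxz; rfl
    · exact hx hxz
  have hd : Differentiable ℂ F := fun z => ((hG z).congr (hF z).symm).differentiableAt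
  have hFp : ∀ z, ∀ l ∈ L.lattice, F (z + l) = F z := by
    intro z l hl
    refine gd_unique (g := fun x => g (x + l)) (G₁ := fun x => G (z + l) (x + l)) (G₂ := G z) (z := z) ?_ ?_ (hG z) ?_
    · exact AnalyticAt.fun_comp (f := fun x => x + l) (by simpa using hG (z+l)) (by fun_prop)
    · exact (tendsto_shift z l).eventually (he (z + l))
    · filter_upwards [hp l hl z, he z] with x h1 h2
      rw [h1, h2, one_mul]
  refine ⟨F 0, fun z G' hG' he' => ?_⟩
  rw [gd_unique hG' he' (hG z) (he z)]
  exact hd.apply_eq_apply_of_bounded (IsZLattice.isCompact_range_of_periodic L.lattice _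
    hd.continuous fun z w hw ↦ hFp z w hw).isBounded z 0

/-- The zeta function of a lattice with its polar term at `0` removed. -/
noncomputable def zE (L : PeriodPair) (z : ℂ) : ℂ :=
  ∑' l : L.lattice, if l.1 = 0 then 0 else (1 / (z - l) + 1 / l + z / l ^ 2)

/-- The zeta function of a lattice. -/
noncomputable def zt (L : PeriodPair) (z : ℂ) : ℂ := 1 / z + zE L z

lemma zeta_bound (r : ℝ) (hr : 0 < r) (s : ℂ) (hs : ‖s‖ < r) (l : ℂ) (h : 2 * r ≤ ‖l‖) :
    ‖1 / (s - l) + 1 / l + s / l ^ 2‖ ≤ 2 * r ^ 2 * ‖l‖ ^ (-3 : ℝ) := by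
  have h1 : s ≠ l := by rintro rfl; linarith
  have h2 : 0 < ‖l‖ := by linarith
  have h3 : l ≠ 0 := norm_pos_iff.1 h2
  have h4 : s - l ≠ 0 := sub_ne_zero.2 h1
  have e : 1 / (s - l) + 1 / l + s / l ^ 2 = s ^ 2 / ((s - l) * l ^ 2) := by
    field_simp; ring
  have h5 : ‖l‖ / 2 ≤ ‖s - l‖ := by
    rw [norm_sub_rev]
    exact .trans (by linarith) (norm_sub_norm_le l s)
  calc _ = ‖s‖ ^ 2 / (‖s - l‖ * ‖l‖ ^ 2) := by rw [e]; simp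
    _ ≤ r ^ 2 / (‖l‖ / 2 * ‖l‖ ^ 2) := by gcongr
    _ = 2 * r ^ 2 / ‖l‖ ^ 3 := by field_simp
    _ = _ := by norm_cast

lemma zE_hslu (L : PeriodPair) : HasSumLocallyUniformly
      (fun (l : L.lattice) (z : ℂ) ↦ if l.1 = 0 then 0 else (1 / (z - l) + 1 / l + z / l ^ 2))
      (zE L) := by
  refine L.hasSumLocallyUniformly_aux (u := (2 * · ^ 2 * ‖·‖ ^ (-3 : ℝ))) _
    (fun _ _ ↦ (ZLattice.summable_norm_rpow _ _ (by simp; norm_num)).mul_left _) fun r hr ↦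
    Filter.eventually_atTop.mpr ⟨2 * r, ?_⟩
  rintro _ h s hs l rfl
  split_ifs
  · simpa using! show 0 ≤ 2 * r ^ 2 * (‖l.1‖ ^ 3)⁻¹ by positivity
  · exact zeta_bound r hr s hs l h

lemma zE_term_hasDeriv (L : PeriodPair) (z : ℂ) (hz : z ∈ ((L.lattice : Set ℂ) \ {0})ᶜ)
    (l : L.lattice) : HasDerivAt (fun z : ℂ => if l.1 = 0 then 0 else (1 / (z - l) + 1 / l + z / l ^ 2))
      (-(if l.1 = 0 then 0 else (1 / (z - l) ^ 2 - 1 / (l : ℂ) ^ 2))) z := by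
  split_ifs with hl
  · simpa using hasDerivAt_const z (0 : ℂ)
  · have h1 : z - l ≠ 0 := fun e => hl (by
      obtain rfl := sub_eq_zero.mp e
      simpa using hz)
    have h2 := (((hasDerivAt_id z).sub_const (l : ℂ)).inv h1).add_const (1 / (l : ℂ))
    have h3 := h2.add ((hasDerivAt_id z).div_const ((l : ℂ) ^ 2))
    convert! h3 using 1
    · ext x; simp
    · simp; ring

lemma zE_differentiableOn (L : PeriodPair) :
    DifferentiableOn ℂ (zE L) ((L.lattice : Set ℂ) \ {0})ᶜ := by
  refine (zE_hslu L).hasSumLocallyUniformlyOn.differentiableOn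
    (.of_forall fun s ↦ .fun_sum fun i hi ↦ ?_) L.isOpen_compl_lattice_sdiff
  intro z hz
  exact (zE_term_hasDeriv L z hz i).differentiableAt.differentiableWithinAt

lemma zE_deriv (L : PeriodPair) :
    Set.EqOn (deriv (zE L)) (fun z => - L.weierstrassPExcept 0 z) ((L.lattice : Set ℂ) \ {0})ᶜ := by
  intro z hz
  have h1 := ((zE_hslu L).tendstoLocallyUniformlyOn (s := ((L.lattice : Set ℂ) \ {0})ᶜ)).deriv
    (.of_forall fun s ↦ .fun_sum fun i hi ↦ fun z hz =>
      (zE_term_hasDeriv L z hz i).differentiableAt.differentiableWithinAt) L.isOpen_compl_lattice_sdiff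
  have h2 := h1.tendsto_at hz
  have h3 := (L.hasSum_weierstrassPExcept 0 z).neg
  refine tendsto_nhds_unique h2 (Tendsto.congr ?_ h3)
  intro s
  simp only [Function.comp_apply]
  exact ((HasDerivAt.fun_sum fun i _ => zE_term_hasDeriv L z hz i).deriv).symm

lemma zE_analytic (L : PeriodPair) {z : ℂ} (hz : z ∈ ((L.lattice : Set ℂ) \ {0})ᶜ) :
    AnalyticAt ℂ (zE L) z :=
  (zE_differentiableOn L).analyticOnNhd L.isOpen_compl_lattice_sdiff z hz

lemma zE_neg (L : PeriodPair) (z : ℂ) : zE L (-z) = - zE L z := by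
  simp only [zE]
  rw [← (Equiv.neg L.lattice).tsum_eq, ← tsum_neg]
  congr with l
  by_cases h : l.1 = 0
  · simp [h]
  · simp [h]
    rw [show -z + l.1 = -(z - l.1) by ring, inv_neg]
    ring

lemma zE_zero (L : PeriodPair) : zE L 0 = 0 := by
  simp [zE]

lemma zt_neg (L : PeriodPair) (z : ℂ) : zt L (-z) = - zt L z := by
  simp [zt, zE_neg]; ring

lemma wP_eq (L : PeriodPair) (z : ℂ) : L.weierstrassP z = L.weierstrassPExcept 0 z + 1 / z ^ 2 := by
  have := L.weierstrassPExcept_add 0 z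
  simp at this
  rw [← this]; simp

lemma wPd_eq (L : PeriodPair) (z : ℂ) :
    L.derivWeierstrassP z = L.derivWeierstrassPExcept 0 z - 2 / z ^ 3 := by
  have := L.derivWeierstrassPExcept_sub 0 z
  simp at this
  rw [← this]

lemma zt_hasDeriv (L : PeriodPair) {z : ℂ} (hz : z ∉ L.lattice) :
    HasDerivAt (zt L) (- L.weierstrassP z) z := by
  have h0 : z ≠ 0 := by rintro rfl; exact hz (zero_mem _)
  have hm : z ∈ ((L.lattice : Set ℂ) \ {0})ᶜ := fun h => hz h.1
  have h1 := (zE_analytic L hm).differentiableAt.hasDerivAt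
  rw [zE_deriv L hm] at h1
  have h2 := (hasDerivAt_inv h0).add h1
  convert! h2 using 1
  · ext x; simp [zt]
  · rw [wP_eq]; simp

lemma zt_analytic (L : PeriodPair) {z : ℂ} (hz : z ∉ L.lattice) : AnalyticAt ℂ (zt L) z := by
  have : DifferentiableOn ℂ (zt L) (L.lattice : Set ℂ)ᶜ := fun x hx =>
    (zt_hasDeriv L hx).differentiableAt.differentiableWithinAt
  exact this.analyticOnNhd L.isClosed_lattice.isOpen_compl z hz

lemma lat_conn (L : PeriodPair) : IsPreconnected (L.lattice : Set ℂ)ᶜ := by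
  refine (Set.Countable.isConnected_compl_of_one_lt_rank (by rw [Complex.rank_real_complex]; exact Nat.one_lt_ofNat) ?_).isPreconnected
  exact Set.countable_coe_iff.1 (L.latticeEquivProd.toEquiv.countable_iff.2 inferInstance)

lemma zt_quasi (L : PeriodPair) {l : ℂ} (hl : l ∈ L.lattice) :
    ∃ η, ∀ z, z ∉ L.lattice → zt L (z + l) = zt L z + η := by
  have hadd : ∀ z, z ∉ L.lattice → z + l ∉ L.lattice := fun z hz h =>
    hz (by simpa using sub_mem h hl)
  have hd : ∀ z, z ∉ L.lattice → HasDerivAt (fun z => zt L (z + l) - zt L z) 0 z := by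
    intro z hz
    have h1 := (zt_hasDeriv L (hadd z hz)).comp_add_const z l
    have h2 := h1.sub (zt_hasDeriv L hz)
    have : L.weierstrassP (z + l) = L.weierstrassP z := L.weierstrassP_add_coe z ⟨l, hl⟩
    rw [this, sub_self] at h2
    exact h2
  obtain ⟨c, hc⟩ := L.isClosed_lattice.isOpen_compl.exists_is_const_of_deriv_eq_zero (lat_conn L)
    (fun z hz => (hd z hz).differentiableAt.differentiableWithinAt) (fun z hz => (hd z hz).deriv)
  exact ⟨c, fun z hz => by have := hc z hz; linear_combination this⟩

lemma zt_quasi_two (L : PeriodPair) {w : ℂ} (hw : w ∉ L.lattice) (h2 : 2 * w ∈ L.lattice)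
    {z : ℂ} (hz : z ∉ L.lattice) : zt L (z + 2 * w) = zt L z + 2 * zt L w := by
  obtain ⟨η, h⟩ := zt_quasi L h2
  have h3 := h (-w) (by simpa using hw)
  rw [show -w + 2 * w = w by ring, zt_neg] at h3
  rw [h z hz]; linear_combination -h3

lemma wP_analytic (L : PeriodPair) {z : ℂ} (hz : z ∉ L.lattice) :
    AnalyticAt ℂ L.weierstrassP z := L.analyticOnNhd_weierstrassP z hz

lemma wPd_analytic (L : PeriodPair) {z : ℂ} (hz : z ∉ L.lattice) :
    AnalyticAt ℂ L.derivWeierstrassP z := L.analyticOnNhd_derivWeierstrassP z hz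

lemma wP_add (L : PeriodPair) {l : ℂ} (hl : l ∈ L.lattice) (z : ℂ) :
    L.weierstrassP (z + l) = L.weierstrassP z := L.weierstrassP_add_coe z ⟨l, hl⟩

lemma wPd_add (L : PeriodPair) {l : ℂ} (hl : l ∈ L.lattice) (z : ℂ) :
    L.derivWeierstrassP (z + l) = L.derivWeierstrassP z := L.derivWeierstrassP_add_coe z ⟨l, hl⟩

lemma wP_near_zero (L : PeriodPair) (e : ℂ) :
    ∀ᶠ z in 𝓝 (0 : ℂ), 1 + z ^ 2 * (L.weierstrassPExcept 0 z - e) ≠ 0 := by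
  have h := (L.analyticAt_weierstrassPExcept 0).continuousAt
  have : ContinuousAt (fun z => 1 + z ^ 2 * (L.weierstrassPExcept 0 z - e)) 0 := by fun_prop
  exact this.eventually_ne (by simp)

lemma wP_ne_near_zero (L : PeriodPair) (e : ℂ) : ∀ᶠ z in 𝓝[≠] (0 : ℂ), L.weierstrassP z ≠ e := by
  filter_upwards [mem_nhdsWithin_of_mem_nhds (wP_near_zero L e), self_mem_nhdsWithin] with z h1 h2 h3
  apply h1
  have : z ≠ 0 := h2
  rw [wP_eq] at h3
  rw [← h3]; field_simp; ring

lemma mem_add_iff {L : PeriodPair} {l : ℂ} (hl : l ∈ L.lattice) (z : ℂ) :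
    z + l ∈ L.lattice ↔ z ∈ L.lattice :=
  ⟨fun h => by simpa using sub_mem h hl, fun h => add_mem h hl⟩

lemma wPd_half (L : PeriodPair) {w : ℂ} (h2 : 2 * w ∈ L.lattice) : L.derivWeierstrassP w = 0 := by
  have h := wPd_add L h2 (-w)
  rw [show -w + 2 * w = w by ring, L.derivWeierstrassP_neg] at h
  linear_combination h / 2

lemma mem_w {L : PeriodPair} {w z : ℂ} (h2 : 2 * w ∈ L.lattice) :
    z + w ∈ L.lattice ↔ z - w ∈ L.lattice := by
  rw [← mem_add_iff h2 (z - w)]; ring_nf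

lemma not_mem_w {L : PeriodPair} {w z : ℂ} (h2 : 2 * w ∈ L.lattice) (h : 2 * z ∉ L.lattice) :
    z + w ∉ L.lattice := by
  intro h'
  apply h
  have := sub_mem (add_mem h' h') h2
  convert this using 1; ring

lemma prod_const (L : PeriodPair) {w : ℂ} (hw : w ∉ L.lattice) (h2 : 2 * w ∈ L.lattice) :
    ∃ c, ∀ z, z ∉ L.lattice → z - w ∉ L.lattice →
      (L.weierstrassP z - L.weierstrassP w) * (L.weierstrassP (z + w) - L.weierstrassP w) = c := by
  set e := L.weierstrassP w with he
  let g : ℂ → ℂ := fun z => (L.weierstrassP z - e) * (L.weierstrassP (z + w) - e)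
  have h0 : Gd g 0 := by
    have ha : AnalyticAt ℂ (fun z => L.weierstrassP (z + w) - e) 0 := by
      refine AnalyticAt.sub ?_ analyticAt_const
      exact AnalyticAt.fun_comp (f := fun x => x + w) (by simpa using wP_analytic L hw) (by fun_prop)
    have hd : deriv (fun z => L.weierstrassP (z + w) - e) 0 = 0 := by
      rw [deriv_sub_const, deriv_comp_add_const, L.deriv_weierstrassP, zero_add, wPd_half L h2]
    have ho : ((2 : ℕ) : ℕ∞) ≤ analyticOrderAt (fun z => L.weierstrassP (z + w) - e) 0 := by
      rw [natCast_le_analyticOrderAt_iff_iteratedDeriv_eq_zero ha]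
      intro i hi
      interval_cases i
      · simp [he]
      · simpa using hd
    obtain ⟨b, hb, hbe⟩ := (natCast_le_analyticOrderAt ha).1 ho
    have hE := L.analyticAt_weierstrassPExcept 0
    refine ⟨fun z => (1 + z ^ 2 * (L.weierstrassPExcept 0 z - e)) * b z, by fun_prop, ?_⟩
    filter_upwards [mem_nhdsWithin_of_mem_nhds hbe, self_mem_nhdsWithin] with z h3 h4
    have : z ≠ 0 := h4
    simp only [g]
    rw [h3, wP_eq]
    simp; field_simp; ring
  have hgw : Gd g w := by
    have := gd_shift (a := w) (κ := 1) h0 (.of_forall fun x => by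
      simp only [g]
      rw [add_assoc, ← two_mul, wP_add L h2]; ring)
    simpa using this
  have han : ∀ z, z ∉ L.lattice → z - w ∉ L.lattice → AnalyticAt ℂ g z := by
    intro z h3 h4
    have h5 : AnalyticAt ℂ (fun z => L.weierstrassP (z + w)) z :=
      AnalyticAt.fun_comp (f := fun x => x + w) (wP_analytic L (by rwa [mem_w h2])) (by fun_prop)
    have h6 := wP_analytic L h3
    exact (h6.sub analyticAt_const).mul (h5.sub analyticAt_const)
  obtain ⟨c, hc⟩ := liouville L g w (fun l hl z _ => by
    simp only [g]
    rw [wP_add L hl, show z + l + w = z + w + l by ring, wP_add L hl]) h0 hgw han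
  exact ⟨c, fun z h3 h4 => hc z g (han z h3 h4) EventuallyEq.rfl⟩

lemma wP_ne_e (L : PeriodPair) {w : ℂ} (hw : w ∉ L.lattice) (h2 : 2 * w ∈ L.lattice)
    {z : ℂ} (hz : z ∉ L.lattice) (hzw : z - w ∉ L.lattice) :
    L.weierstrassP z ≠ L.weierstrassP w := by
  intro h
  obtain ⟨c, hc⟩ := prod_const L hw h2
  have hc0 : c = 0 := by rw [← hc z hz hzw, h]; simp
  subst hc0
  have h1 : ∀ᶠ x in 𝓝[≠] (0 : ℂ), L.weierstrassP (x + w) = L.weierstrassP w := by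
    filter_upwards [ev_not_mem2 L 0, wP_ne_near_zero L (L.weierstrassP w)] with x h3 h4
    have := hc x (not_mem_of_two h3) (by rw [← mem_w h2]; exact not_mem_w h2 h3)
    rcases mul_eq_zero.1 this with h5 | h5
    · exact absurd (sub_eq_zero.1 h5) h4
    · exact sub_eq_zero.1 h5
  have h3 : ∀ᶠ x in 𝓝[≠] w, L.weierstrassP x = L.weierstrassP w := by
    have := tendsto_shift w (-w)
    rw [add_neg_cancel] at this
    filter_upwards [this.eventually h1] with x hx
    simpa using hx
  have h4 := L.analyticOnNhd_weierstrassP.eqOn_of_preconnected_of_frequently_eq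
    (g := fun _ => L.weierstrassP w) (fun _ _ => analyticAt_const) (lat_conn L) hw h3.frequently
  obtain ⟨x, hx1, hx2⟩ := ((ev_not_mem L 0).and (wP_ne_near_zero L (L.weierstrassP w))).exists
  exact hx2 (h4 hx1)

lemma prod_const_deriv (L : PeriodPair) {w : ℂ} (hw : w ∉ L.lattice) (h2 : 2 * w ∈ L.lattice)
    {z : ℂ} (hz : z ∉ L.lattice) (hzw : z - w ∉ L.lattice) :
    L.derivWeierstrassP z * (L.weierstrassP (z + w) - L.weierstrassP w) +
      (L.weierstrassP z - L.weierstrassP w) * L.derivWeierstrassP (z + w) = 0 := by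
  obtain ⟨c, hc⟩ := prod_const L hw h2
  have h1 : ∀ x, x ∉ L.lattice → HasDerivAt L.weierstrassP (L.derivWeierstrassP x) x := fun x hx => by
    rw [← L.deriv_weierstrassP]; exact (wP_analytic L hx).differentiableAt.hasDerivAt
  have h3 := ((h1 z hz).sub_const (L.weierstrassP w)).mul
    (((h1 (z + w) (by rwa [mem_w h2])).comp_add_const z w).sub_const (L.weierstrassP w))
  have hev : ∀ᶠ x in 𝓝 z, x ∉ L.lattice ∧ x - w ∉ L.lattice := by
    refine Filter.Eventually.and (L.isClosed_lattice.isOpen_compl.mem_nhds hz) ?_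
    have : ContinuousAt (fun x : ℂ => x - w) z := by fun_prop
    exact this.eventually (L.isClosed_lattice.isOpen_compl.mem_nhds hzw)
  have h4 : HasDerivAt (fun _ => c) _ z := h3.congr_of_eventuallyEq (by
    filter_upwards [hev] with x hx
    exact (hc x hx.1 hx.2).symm)
  exact h4.unique (hasDerivAt_const z c)

lemma zt_half (L : PeriodPair) {w : ℂ} (hw : w ∉ L.lattice) (h2 : 2 * w ∈ L.lattice)
    {z : ℂ} (hz : z ∉ L.lattice) (hzw : z - w ∉ L.lattice) :
    zt L (z + w) - zt L z - zt L w =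
      L.derivWeierstrassP z / (2 * (L.weierstrassP z - L.weierstrassP w)) := by
  set e := L.weierstrassP w with he
  let g : ℂ → ℂ := fun z => (zt L (z + w) - zt L z - zt L w) -
    L.derivWeierstrassP z / (2 * (L.weierstrassP z - e))
  have hsh : AnalyticAt ℂ (fun z => zt L (z + w)) 0 :=
    AnalyticAt.fun_comp (f := fun x => x + w) (by simpa using zt_analytic L hw) (by fun_prop)
  have hE := L.analyticAt_weierstrassPExcept 0
  have hE' := L.analyticAt_derivWeierstrassPExcept 0
  have hzE : AnalyticAt ℂ (zE L) 0 := zE_analytic L (by simp)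
  let G : ℂ → ℂ := fun z => zt L (z + w) - zE L z - zt L w -
    (z ^ 2 * L.derivWeierstrassPExcept 0 z + 2 * z * (L.weierstrassPExcept 0 z - e)) /
      (2 * (1 + z ^ 2 * (L.weierstrassPExcept 0 z - e)))
  have hG : AnalyticAt ℂ G 0 := by
    refine AnalyticAt.sub (by fun_prop) (AnalyticAt.div (by fun_prop) (by fun_prop) (by simp))
  have hgG : g =ᶠ[𝓝[≠] 0] G := by
    filter_upwards [mem_nhdsWithin_of_mem_nhds (wP_near_zero L e), self_mem_nhdsWithin] with z h3 h4
    have h5 : z ≠ 0 := h4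
    simp only [g, G]
    rw [wP_eq, wPd_eq]
    simp only [zt]
    have h6 : L.weierstrassPExcept 0 z + 1 / z ^ 2 - e =
      (1 + z ^ 2 * (L.weierstrassPExcept 0 z - e)) / z ^ 2 := by field_simp; ring
    rw [h6]
    generalize hD : 1 + z ^ 2 * (L.weierstrassPExcept 0 z - e) = D at *
    have h7 : L.weierstrassPExcept 0 z - e = (D - 1) / z ^ 2 := by rw [← hD]; field_simp; ring
    rw [h7]
    field_simp
    ring
  have hanti : ∀ x, 2 * x ∉ L.lattice → g (x + w) = -1 * g x := by
    intro x hx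
    have h3 := not_mem_of_two hx
    have h4 := not_mem_w h2 hx
    have h5 := h4
    rw [mem_w h2] at h5
    have h6 := prod_const_deriv L hw h2 h3 h5
    have h7 := zt_quasi_two L hw h2 h3
    have h8 := wP_ne_e L hw h2 h3 h5
    have h9 := wP_ne_e L hw h2 (z := x + w) h4 (by simpa using h3)
    rw [← he] at h6 h8 h9
    have h8' := sub_ne_zero.2 h8
    have h9' := sub_ne_zero.2 h9
    simp only [g]
    rw [add_assoc x w w, ← two_mul, h7]
    have h10 : L.derivWeierstrassP (x + w) / (2 * (L.weierstrassP (x + w) - e)) =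
      - (L.derivWeierstrassP x / (2 * (L.weierstrassP x - e))) := by
      field_simp
      linear_combination h6
    rw [h10]; ring
  have h0 : Gd g 0 := ⟨G, hG, hgG⟩
  have hgw : Gd g w := by
    have := gd_shift (a := w) (κ := -1) h0 (by
      filter_upwards [ev_not_mem2 L 0] with x hx using hanti x hx)
    simpa using this
  have han : ∀ z, z ∉ L.lattice → z - w ∉ L.lattice → AnalyticAt ℂ g z := by
    intro z h3 h4
    have h5 : AnalyticAt ℂ (fun z => zt L (z + w)) z :=
      AnalyticAt.fun_comp (f := fun x => x + w) (zt_analytic L (by rwa [mem_w h2])) (by fun_prop)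
    have h6 := wP_analytic L h3
    have h7 := wPd_analytic L h3
    have h8 := zt_analytic L h3
    refine AnalyticAt.sub (by fun_prop) (AnalyticAt.div h7 (by fun_prop) ?_)
    exact mul_ne_zero two_ne_zero (sub_ne_zero.2 (wP_ne_e L hw h2 h3 h4))
  obtain ⟨c, hc⟩ := liouville L g w (fun l hl z hz => by
    obtain ⟨η, hη⟩ := zt_quasi L hl
    simp only [g]
    rw [wP_add L hl, wPd_add L hl, show z + l + w = z + w + l by ring, hη z (not_mem_of_two hz),
      hη (z + w) (not_mem_w h2 hz)]
    ring) h0 hgw han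
  have hc0 : c = 0 := by
    rw [← hc 0 G hG hgG]
    simp [G, zE_zero]
  have := hc z g (han z hz hzw) EventuallyEq.rfl
  rw [hc0] at this
  exact sub_eq_zero.1 this

/-- Weak form of the Legendre relation. -/
lemma legendre_ne (L : PeriodPair) {w₁ w₂ : ℂ} (hw₁ : w₁ ∉ L.lattice) (h₁ : 2 * w₁ ∈ L.lattice)
    (hw₂ : w₂ ∉ L.lattice) (h₂ : 2 * w₂ ∈ L.lattice) (h12 : w₁ - w₂ ∉ L.lattice)
    (hgen : ∀ l ∈ L.lattice, ∃ m n : ℤ, l = m * (2 * w₁) + n * (2 * w₂)) :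
    zt L w₁ * w₂ ≠ zt L w₂ * w₁ := by
  intro h
  have hw0 : w₁ ≠ 0 := by rintro rfl; exact hw₁ (zero_mem _)
  obtain ⟨k, hk₁, hk₂⟩ : ∃ k, zt L w₁ = k * w₁ ∧ zt L w₂ = k * w₂ :=
    ⟨zt L w₁ / w₁, by field_simp, by field_simp; linear_combination -h⟩
  let f : ℂ → ℂ := fun z => zt L z - k * z
  let g : ℂ → ℂ := fun z => f z ^ 2 - L.weierstrassP z
  let H : AddSubgroup ℂ :=
    { carrier := {l | l ∈ L.lattice ∧ ∀ z, z ∉ L.lattice → f (z + l) = f z}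
      zero_mem' := ⟨zero_mem _, by simp⟩
      add_mem' := by
        rintro a b ⟨ha, ha'⟩ ⟨hb, hb'⟩
        refine ⟨add_mem ha hb, fun z hz => ?_⟩
        rw [← add_assoc, hb' _ (by rwa [mem_add_iff ha]), ha' z hz]
      neg_mem' := by
        rintro a ⟨ha, ha'⟩
        refine ⟨neg_mem ha, fun z hz => ?_⟩
        rw [← ha' (z + -a) (by rwa [mem_add_iff (neg_mem ha)])]; simp }
  have hH₁ : 2 * w₁ ∈ H := ⟨h₁, fun z hz => by
    simp only [f]; rw [zt_quasi_two L hw₁ h₁ hz, hk₁]; ring⟩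
  have hH₂ : 2 * w₂ ∈ H := ⟨h₂, fun z hz => by
    simp only [f]; rw [zt_quasi_two L hw₂ h₂ hz, hk₂]; ring⟩
  have hper : ∀ l ∈ L.lattice, ∀ z, z ∉ L.lattice → f (z + l) = f z := by
    intro l hl
    obtain ⟨m, n, rfl⟩ := hgen l hl
    have := H.add_mem (H.zsmul_mem hH₁ m) (H.zsmul_mem hH₂ n)
    simp only [zsmul_eq_mul] at this
    exact this.2
  have hzE : AnalyticAt ℂ (zE L) 0 := zE_analytic L (by simp)
  have hE := L.analyticAt_weierstrassPExcept 0
  have h0 : Gd g 0 := by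
    have ho : ((1 : ℕ) : ℕ∞) ≤ analyticOrderAt (fun z => zE L z) 0 := by
      rw [natCast_le_analyticOrderAt_iff_iteratedDeriv_eq_zero hzE]
      intro i hi
      interval_cases i
      simp [zE_zero]
    obtain ⟨b, hb, hbe⟩ := (natCast_le_analyticOrderAt hzE).1 ho
    refine ⟨fun z => 2 * (b z - k) + z ^ 2 * (b z - k) ^ 2 - L.weierstrassPExcept 0 z,
      by fun_prop, ?_⟩
    filter_upwards [mem_nhdsWithin_of_mem_nhds hbe, self_mem_nhdsWithin] with z h3 h4
    have : z ≠ 0 := h4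
    simp only [g, f, zt]
    rw [h3, wP_eq]
    simp; field_simp; ring
  have han : ∀ z, z ∉ L.lattice → AnalyticAt ℂ g z := by
    intro z hz
    have h6 := wP_analytic L hz
    have h8 := zt_analytic L hz
    exact ((h8.sub (analyticAt_const.mul analyticAt_id)).pow 2).sub h6
  obtain ⟨c, hc⟩ := liouville L g w₁ (fun l hl z hz => by
    simp only [g]
    rw [wP_add L hl, hper l hl z (not_mem_of_two hz)]) h0 (gd_of_analytic (han w₁ hw₁))
    (fun z hz _ => han z hz)
  have e1 := hc w₁ g (han _ hw₁) EventuallyEq.rfl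
  have e2 := hc w₂ g (han _ hw₂) EventuallyEq.rfl
  simp only [g, f] at e1 e2
  rw [hk₁] at e1
  rw [hk₂] at e2
  exact wP_ne_e L hw₂ h₂ hw₁ h12 (by linear_combination e2 - e1)

lemma wPd_zero (L : PeriodPair) {w₁ w₂ : ℂ} (hw₁ : w₁ ∉ L.lattice) (h₁ : 2 * w₁ ∈ L.lattice)
    (hw₂ : w₂ ∉ L.lattice) (h₂ : 2 * w₂ ∈ L.lattice) (h12 : w₁ - w₂ ∉ L.lattice)
    {z : ℂ} (hz : z ∉ L.lattice) (h : L.derivWeierstrassP z = 0) : 2 * z ∈ L.lattice := by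
  by_contra hcon
  have key : ∀ w, 2 * w ∈ L.lattice → z - w ∉ L.lattice := by
    intro w hw h'
    apply hcon
    have := add_mem (add_mem h' h') hw
    convert this using 1; ring
  have hs : w₁ + w₂ ∉ L.lattice := by rwa [mem_w h₂]
  have h2s : 2 * (w₁ + w₂) ∈ L.lattice := by rw [mul_add]; exact add_mem h₁ h₂
  have n1 := wP_ne_e L hw₁ h₁ hz (key _ h₁)
  have n2 := wP_ne_e L hw₂ h₂ hz (key _ h₂)
  have n3 := wP_ne_e L hs h2s hz (key _ h2s)
  have n4 := wP_ne_e L hw₂ h₂ hw₁ h12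
  have n5 := wP_ne_e L hw₁ h₁ hs (by simpa using hw₂)
  have n6 := wP_ne_e L hw₂ h₂ hs (by simpa using hw₁)
  have q0 := L.derivWeierstrassP_sq z hz
  have q1 := L.derivWeierstrassP_sq w₁ hw₁
  have q2 := L.derivWeierstrassP_sq w₂ hw₂
  have q3 := L.derivWeierstrassP_sq _ hs
  rw [h] at q0
  rw [wPd_half L h₁] at q1
  rw [wPd_half L h₂] at q2
  rw [wPd_half L h2s] at q3
  generalize L.weierstrassP z = x at *
  generalize L.weierstrassP w₁ = a at *
  generalize L.weierstrassP w₂ = b at *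
  generalize L.weierstrassP (w₁ + w₂) = d at *
  have s1 : 4 * (x ^ 2 + x * a + a ^ 2) = L.g₂ := by
    apply mul_left_cancel₀ (sub_ne_zero.2 n1); linear_combination q1 - q0
  have s2 : 4 * (b ^ 2 + b * a + a ^ 2) = L.g₂ := by
    apply mul_left_cancel₀ (sub_ne_zero.2 n4); linear_combination q2 - q1
  have s3 : 4 * (d ^ 2 + d * a + a ^ 2) = L.g₂ := by
    apply mul_left_cancel₀ (sub_ne_zero.2 n5); linear_combination q1 - q3
  have t1 : x + b + a = 0 := by
    apply mul_left_cancel₀ (sub_ne_zero.2 n2); linear_combination (s1 - s2) / 4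
  have t2 : d + b + a = 0 := by
    apply mul_left_cancel₀ (sub_ne_zero.2 n6); linear_combination (s3 - s2) / 4
  exact n3 (by linear_combination t1 - t2)

lemma indep_tau {τ : ℂ} (hτ : 0 < τ.im) : LinearIndependent ℝ ![(1 : ℂ), τ] := by
  rw [LinearIndependent.pair_iff]
  intro a b h
  have h1 := congrArg Complex.im h
  have h2 := congrArg Complex.re h
  simp at h1 h2
  have hb : b = 0 := by rcases h1 with h1 | h1 <;> [exact h1; exact absurd h1 hτ.ne']
  subst hb
  simpa using h2

/-- The period pair `(1, τ)`. -/
noncomputable def LL (τ : ℂ) (hτ : 0 < τ.im) : PeriodPair := ⟨1, τ, indep_tau hτ⟩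

lemma mem_LL {τ : ℂ} (hτ : 0 < τ.im) (z : ℂ) : z ∈ (LL τ hτ).lattice ↔ z ∈ lat τ := by
  rw [PeriodPair.mem_lattice]
  simp only [LL, lat, Set.mem_setOf_eq, mul_one]
  exact exists_congr fun m => exists_congr fun n => eq_comm

lemma tsum_LL {τ : ℂ} (hτ : 0 < τ.im) (φ : ℂ → ℂ) :
    ∑' p : {p : ℤ × ℤ // p ≠ 0}, φ (latPt τ p.1) =
      ∑' l : (LL τ hτ).lattice, if l.1 = 0 then 0 else φ l.1 := by
  classical
  rw [← (LL τ hτ).latticeEquivProd.symm.toEquiv.tsum_eq]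
  have h1 := tsum_subtype {p : ℤ × ℤ | p ≠ 0} (fun p => φ (latPt τ p))
  refine h1.trans (tsum_congr fun p => ?_)
  have h2 : (((LL τ hτ).latticeEquivProd.symm p).1 : ℂ) = latPt τ p := by
    rw [PeriodPair.latticeEquiv_symm_apply]; simp [LL, latPt]
  have h3 : latPt τ p = 0 ↔ p = 0 := by
    rw [← h2]; simp
  simp only [LinearEquiv.coe_toEquiv, h2, h3, Set.indicator, Set.mem_setOf_eq]
  by_cases hp : p = 0 <;> simp [hp]

lemma wp_LL {τ : ℂ} (hτ : 0 < τ.im) : wp τ = (LL τ hτ).weierstrassP := by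
  ext z
  rw [wP_eq, wp, tsum_LL hτ (fun l => 1 / (z - l) ^ 2 - 1 / l ^ 2), add_comm]
  rfl

lemma wpd_LL {τ : ℂ} (hτ : 0 < τ.im) : wpd τ = (LL τ hτ).derivWeierstrassP := by
  ext z
  rw [wpd, wp_LL hτ, PeriodPair.deriv_weierstrassP]

lemma wzeta_LL {τ : ℂ} (hτ : 0 < τ.im) : wzeta τ = zt (LL τ hτ) := by
  ext z
  rw [zt, wzeta, tsum_LL hτ (fun l => 1 / (z - l) + 1 / l + z / l ^ 2)]
  rfl

lemma half_facts {τ : ℂ} (hτ : 0 < τ.im) :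
    (1 / 2 : ℂ) ∉ (LL τ hτ).lattice ∧ 2 * (1 / 2 : ℂ) ∈ (LL τ hτ).lattice ∧
    τ / 2 ∉ (LL τ hτ).lattice ∧ 2 * (τ / 2) ∈ (LL τ hτ).lattice ∧
    1 / 2 - τ / 2 ∉ (LL τ hτ).lattice := by
  refine ⟨(LL τ hτ).ω₁_div_two_notMem_lattice, ?_, (LL τ hτ).ω₂_div_two_notMem_lattice, ?_, ?_⟩
  · simpa using! (LL τ hτ).ω₁_mem_lattice
  · have := (LL τ hτ).ω₂_mem_lattice
    convert! this using 1
    simp [LL]; ring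
  · have := ((LL τ hτ).mul_ω₁_add_mul_ω₂_mem_lattice (α := 1 / 2) (β := -1 / 2)).not.mpr
      (by norm_num)
    convert this using 2
    simp [LL]; ring

lemma final_zero {r s τ : ℂ} (hrs : ¬ IsHalfIntPair r s) (hτ : 0 < τ.im)
    (hz : r + s * τ ∉ lat τ) (hd : wpd τ (r + s * τ) = 0) (h0 : heckeZ r s τ = 0) : False := by
  obtain ⟨a1, a2, b1, b2, ab⟩ := half_facts hτ
  rw [← mem_LL hτ] at hz
  rw [wpd_LL hτ] at hd
  have h2 := wPd_zero _ a1 a2 b1 b2 ab hz hd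
  have hgen : ∀ l ∈ (LL τ hτ).lattice, ∃ m n : ℤ, l = m * (2 * (1 / 2 : ℂ)) + n * (2 * (τ / 2)) := by
    intro l hl
    rw [mem_LL hτ] at hl
    obtain ⟨m, n, h⟩ := hl
    exact ⟨m, n, by rw [h]; ring⟩
  have hleg := legendre_ne _ a1 a2 b1 b2 ab hgen
  -- the quasi-periods
  have hq : zt (LL τ hτ) (r + s * τ + -(r + s * τ)  + (r + s * τ)) = zt (LL τ hτ) (r + s * τ) := by
    congr 1; ring
  obtain ⟨m, n, hmn⟩ := (mem_LL hτ _).1 h2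
  -- additive homomorphism of quasi-periods
  let H : AddSubgroup ℂ :=
    { carrier := {l | l ∈ (LL τ hτ).lattice ∧ ∃ m n : ℤ, l = m + n * τ ∧ ∀ z, z ∉ (LL τ hτ).lattice →
          zt (LL τ hτ) (z + l) = zt (LL τ hτ) z + m * eta1 τ + n * eta2 τ}
      zero_mem' := ⟨zero_mem _, 0, 0, by simp, by simp⟩
      add_mem' := by
        rintro a b ⟨ha, m, n, e, h⟩ ⟨hb, m', n', e', h'⟩
        refine ⟨add_mem ha hb, m + m', n + n', by rw [e, e']; push_cast; ring, fun z hz => ?_⟩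
        rw [← add_assoc, h' _ (by rwa [mem_add_iff ha]), h z hz]; push_cast; ring
      neg_mem' := by
        rintro a ⟨ha, m, n, e, h⟩
        refine ⟨neg_mem ha, -m, -n, by rw [e]; push_cast; ring, fun z hz => ?_⟩
        have := h (z + -a) (by rwa [mem_add_iff (neg_mem ha)])
        rw [neg_add_cancel_right] at this
        rw [this]; push_cast; ring }
  have hH1 : (1 : ℂ) ∈ H := by
    refine ⟨by simpa using a2, 1, 0, by simp, fun z hz => ?_⟩
    have := zt_quasi_two _ a1 a2 hz
    rw [show (2 : ℂ) * (1 / 2) = 1 by norm_num] at this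
    rw [this, eta1, wzeta_LL hτ]; simp
  have hH2 : τ ∈ H := by
    have e : (2 : ℂ) * (τ / 2) = τ := by ring
    refine ⟨by rw [e] at b2; exact b2, 0, 1, by simp, fun z hz => ?_⟩
    have := zt_quasi_two _ b1 b2 hz
    rw [e] at this
    rw [this, eta2, wzeta_LL hτ]; simp
  have hHm : (m : ℂ) + n * τ ∈ H := by
    have := H.add_mem (H.zsmul_mem hH1 m) (H.zsmul_mem hH2 n)
    simpa only [zsmul_eq_mul, mul_one] using this
  obtain ⟨-, m', n', e, hη⟩ := hHm
  have hz2 := hη (-(r + s * τ)) (by rwa [neg_mem_iff])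
  rw [← hmn, show -(r + s * τ) + 2 * (r + s * τ) = r + s * τ by ring, zt_neg] at hz2
  rw [← hmn] at e
  rw [heckeZ, wzeta_LL hτ] at h0
  have e1 : (s - n' / 2) * τ = -(r - m' / 2) := by linear_combination e / 2
  have e2 : (r - m' / 2) * eta1 τ + (s - n' / 2) * eta2 τ = 0 := by
    linear_combination hz2 / 2 - h0
  have e3 : (s - n' / 2) * (eta2 τ - τ * eta1 τ) = 0 := by
    linear_combination e2 - eta1 τ * e1
  have e4 : eta2 τ - τ * eta1 τ ≠ 0 := by
    intro h
    apply hleg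
    rw [eta1, eta2, wzeta_LL hτ] at h
    linear_combination -h / 4
  have e5 : s - n' / 2 = 0 := (mul_eq_zero.1 e3).resolve_right e4
  rw [e5, zero_mul] at e1
  exact hrs ⟨m', n', by linear_combination e1, by linear_combination e5⟩

lemma ident2 {r s τ : ℂ} (hτ : 0 < τ.im) (h1 : r + s * τ ∉ lat τ) (h2 : r + s * τ - τ / 2 ∉ lat τ) :
    heckeZ r (s + 1 / 2) τ =
        heckeZ r s τ + wpd τ (r + s * τ) / (2 * (wp τ (r + s * τ) - eper τ 2)) ∧
    wp τ (r + s * τ) - eper τ 2 ≠ 0 := by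
  obtain ⟨a1, a2, b1, b2, ab⟩ := half_facts hτ
  rw [← mem_LL hτ] at h1 h2
  have h := zt_half _ b1 b2 h1 h2
  have hn := sub_ne_zero.2 (wP_ne_e _ b1 b2 h1 h2)
  simp only [heckeZ, eper, per, eta1, eta2, wpd_LL hτ, wp_LL hτ, wzeta_LL hτ]
  refine ⟨?_, hn⟩
  rw [← h, show r + (s + 1 / 2) * τ = r + s * τ + τ / 2 by ring]
  ring

lemma ident1 {r s τ : ℂ} (hτ : 0 < τ.im) (h1 : r + s * τ ∉ lat τ) (h2 : r + s * τ - 1 / 2 ∉ lat τ) :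
    heckeZ (r + 1 / 2) s τ =
        heckeZ r s τ + wpd τ (r + s * τ) / (2 * (wp τ (r + s * τ) - eper τ 1)) ∧
    wp τ (r + s * τ) - eper τ 1 ≠ 0 := by
  obtain ⟨a1, a2, b1, b2, ab⟩ := half_facts hτ
  rw [← mem_LL hτ] at h1 h2
  have h := zt_half _ a1 a2 h1 h2
  have hn := sub_ne_zero.2 (wP_ne_e _ a1 a2 h1 h2)
  simp only [heckeZ, eper, per, eta1, eta2, wpd_LL hτ, wp_LL hτ, wzeta_LL hτ]
  refine ⟨?_, hn⟩
  rw [← h, show r + 1 / 2 + s * τ = r + s * τ + 1 / 2 by ring]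
  ring

lemma quot_zero {a b x d : ℂ} (h : b = a + x / (2 * d)) (hd : d ≠ 0) (ha : a = 0) (hb : b = 0) :
    x = 0 := by
  rw [ha, hb, zero_add] at h
  rcases div_eq_zero_iff.1 h.symm with h | h
  · exact h
  · exact absurd h (mul_ne_zero two_ne_zero hd)

/-- **Theorem (Statement 18).** For `(r,s) ∈ ℂ² ∖ (1/2)ℤ²`: the half-period translation
identities for the Hecke form hold (wherever defined), and consequently `Z(r,s,·)` has no
common zero with `Z(r,s+1/2,·)` nor with `Z(r+1/2,s,·)`. -/
theorem statement18 (r s : ℂ) (hrs : ¬ IsHalfIntPair r s) :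
    (∀ τ : ℂ, 0 < τ.im → r + s * τ ∉ lat τ → r + s * τ - τ / 2 ∉ lat τ →
      heckeZ r (s + 1 / 2) τ =
        heckeZ r s τ + wpd τ (r + s * τ) / (2 * (wp τ (r + s * τ) - eper τ 2))) ∧
    (¬ ∃ τ : ℂ, 0 < τ.im ∧ r + s * τ ∉ lat τ ∧ r + s * τ - τ / 2 ∉ lat τ ∧
      heckeZ r s τ = 0 ∧ heckeZ r (s + 1 / 2) τ = 0) ∧
    (∀ τ : ℂ, 0 < τ.im → r + s * τ ∉ lat τ → r + s * τ - 1 / 2 ∉ lat τ →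
      heckeZ (r + 1 / 2) s τ =
        heckeZ r s τ + wpd τ (r + s * τ) / (2 * (wp τ (r + s * τ) - eper τ 1))) ∧
    (¬ ∃ τ : ℂ, 0 < τ.im ∧ r + s * τ ∉ lat τ ∧ r + s * τ - 1 / 2 ∉ lat τ ∧
      heckeZ r s τ = 0 ∧ heckeZ (r + 1 / 2) s τ = 0) := by
  refine ⟨fun τ hτ h1 h2 => (ident2 hτ h1 h2).1, ?_, fun τ hτ h1 h2 => (ident1 hτ h1 h2).1, ?_⟩
  · rintro ⟨τ, hτ, h1, h2, h3, h4⟩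
    obtain ⟨h5, h6⟩ := ident2 hτ h1 h2
    exact final_zero hrs hτ h1 (quot_zero h5 h6 h3 h4) h3
  · rintro ⟨τ, hτ, h1, h2, h3, h4⟩
    obtain ⟨h5, h6⟩ := ident1 hτ h1 h2
    exact final_zero hrs hτ h1 (quot_zero h5 h6 h3 h4) h3
end
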